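/- arXiv:1907.13253 — 2 statements merged into one kernel-verified Lean document; each statement's English description precedes it below -/
import Mathlib

section
/- Let θ1 = φ1∘λ with φ1 symmetric convex piecewise affine, (X̄,Ȳ) ∈ gph ∂θ1, Ū ∈ 𝕆ⁿ(X̄) ∩ 𝕆ⁿ(Ȳ), and let v̄1 > … > v̄r be the distinct eigenvalues of X̄. Then for every H ∈ C(X̄+Ȳ; ∂θ1(X̄)), the conjugate of the second-order directional derivative satisfies sup_{W∈Sⁿ} { ⟨W,Ȳ⟩ − θ1''(X̄;H,W) } = 2 ∑_{l=1}^{r} ⟨ Λ(Ȳ)_{α^l α^l}, Ūᵀ_{α^l} H (X̄ − v̄_l I)† H Ū_{α^l} ⟩, where (X̄ − v̄_l I)† is the Moore–Penrose pseudo-inverse of X̄ − v̄_l I and Λ(Ȳ) = Diag(λ(Ȳ)). -/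
open Matrix Filter Topology Set
open scoped Classical

noncomputable section

/-- The vector of eigenvalues of a symmetric matrix, in non-increasing order. -/
noncomputable def lamVec {n : ℕ} (X : Matrix (Fin n) (Fin n) ℝ) : Fin n → ℝ :=
  if h : X.IsHermitian then fun i => (h.eigenvalues ∘ Tuple.sort h.eigenvalues) i.rev else 0

/-- The set `𝕆ⁿ(X)` of orthogonal matrices giving an ordered eigenvalue decomposition of `X`. -/
def OSet {n : ℕ} (X : Matrix (Fin n) (Fin n) ℝ) : Set (Matrix (Fin n) (Fin n) ℝ) :=
  {U | Uᵀ * U = 1 ∧ X = U * Matrix.diagonal (lamVec X) * Uᵀ}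

/-- One-sided directional derivative of a scalar function. -/
noncomputable def dirDeriv {E : Type*} [AddCommMonoid E] [Module ℝ E] (f : E → ℝ) (x h : E) : ℝ :=
  limUnder (𝓝[>] (0:ℝ)) fun t => (f (x + t • h) - f x) / t

/-- Vector of one-sided directional derivatives of the ordered eigenvalues: `λ'(X;H)`. -/
noncomputable def lamDD {n : ℕ} (X H : Matrix (Fin n) (Fin n) ℝ) : Fin n → ℝ :=
  fun i => dirDeriv (fun Y => lamVec Y i) X H

/-- The max-of-affine convex piecewise affine function `φ(x) = max_i (⟨aⁱ,x⟩ - cᵢ)`. -/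
noncomputable def pwa {n p : ℕ} [NeZero p] (a : Fin p → Fin n → ℝ) (c : Fin p → ℝ)
    (x : Fin n → ℝ) : ℝ :=
  ⨆ i, (a i ⬝ᵥ x - c i)

/-- The active index set `ι(x̄)` of a max-of-affine function at `x̄`. -/
def iotaA {n p : ℕ} [NeZero p] (a : Fin p → Fin n → ℝ) (c : Fin p → ℝ)
    (x : Fin n → ℝ) : Set (Fin p) :=
  {i | a i ⬝ᵥ x - c i = pwa a c x}

/-- Frobenius inner product of two matrices. -/
def mip {n : ℕ} (A B : Matrix (Fin n) (Fin n) ℝ) : ℝ := (Aᵀ * B).trace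

/-- Convex subdifferential (over the space of symmetric matrices) of a real function. -/
def msubdiff {n : ℕ} (f : Matrix (Fin n) (Fin n) ℝ → ℝ) (X : Matrix (Fin n) (Fin n) ℝ) :
    Set (Matrix (Fin n) (Fin n) ℝ) :=
  {G | G.IsSymm ∧ ∀ Y : Matrix (Fin n) (Fin n) ℝ, Y.IsSymm → f X + mip G (Y - X) ≤ f Y}

/-- Moore–Penrose pseudo-inverse, via the four Penrose conditions. -/
noncomputable def mpInv {n : ℕ} (A : Matrix (Fin n) (Fin n) ℝ) : Matrix (Fin n) (Fin n) ℝ :=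
  Classical.epsilon fun B => A * B * A = A ∧ B * A * B = B ∧ (A * B)ᵀ = A * B ∧ (B * A)ᵀ = B * A

/-- The sigma-term function
`Υ_X(Y,H) = 2 ∑_l ⟨Λ(Y)_{αˡαˡ}, Uᵀ_{αˡ} H (X - v̄ₗ I)† H U_{αˡ}⟩` (written as a single sum
over eigenvalue indices). -/
noncomputable def Upsilon {n : ℕ} (X Y U H : Matrix (Fin n) (Fin n) ℝ) : ℝ :=
  2 * ∑ i, lamVec Y i *
    ((Uᵀ * H * mpInv (X - lamVec X i • (1 : Matrix (Fin n) (Fin n) ℝ)) * H * U) i i)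

/-- Second-order (parabolic) directional derivative of a scalar function. -/
noncomputable def dirDeriv2 {E : Type*} [AddCommMonoid E] [Module ℝ E]
    (f : E → ℝ) (x h w : E) : ℝ :=
  limUnder (𝓝[>] (0:ℝ)) fun t =>
    (f (x + t • h + (t^2/2) • w) - f x - t * dirDeriv f x h) / (t^2/2)


/-! ### Basic facts on the piecewise affine function and on eigenvalues -/

theorem aux_perm_of_multiset {n : ℕ} (f g : Fin n → ℝ)
    (h : Multiset.map f Finset.univ.val = Multiset.map g Finset.univ.val) :
    ∃ σ : Equiv.Perm (Fin n), f = g ∘ σ := by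
  have hc : ∀ v : ℝ, Nonempty ({i // f i = v} ≃ {i // g i = v}) := by
    intro v
    apply Fintype.card_eq.mp
    have := congrArg (Multiset.count v) h
    rw [Multiset.count_map, Multiset.count_map] at this
    rw [Fintype.card_subtype, Fintype.card_subtype]
    simp only [Finset.card_def, Finset.filter_val]
    simpa [eq_comm] using this
  have e := fun v => Classical.choice (hc v)
  refine ⟨(Equiv.sigmaFiberEquiv f).symm.trans
    ((Equiv.sigmaCongrRight e).trans (Equiv.sigmaFiberEquiv g)), ?_⟩
  funext i
  simp only [Function.comp, Equiv.trans_apply]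
  exact ((e (f i)) ⟨i, rfl⟩).2.symm

theorem aux_bdd {n p : ℕ} [NeZero p] (a : Fin p → Fin n → ℝ) (c : Fin p → ℝ) (x : Fin n → ℝ) :
    BddAbove (range fun i => a i ⬝ᵥ x - c i) := (Set.finite_range _).bddAbove

theorem aux_pwa_le {n p : ℕ} [NeZero p] (a : Fin p → Fin n → ℝ) (c : Fin p → ℝ) (x : Fin n → ℝ)
    (i : Fin p) : a i ⬝ᵥ x - c i ≤ pwa a c x := le_ciSup (aux_bdd a c x) i

theorem aux_pwa_lip {n p : ℕ} [NeZero p] (a : Fin p → Fin n → ℝ) (c : Fin p → ℝ)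
    (x y : Fin n → ℝ) (δ : ℝ) (hδ : ∀ j, |x j - y j| ≤ δ) :
    pwa a c x ≤ pwa a c y + (∑ i, ∑ j, |a i j|) * δ := by
  apply ciSup_le
  intro i
  have h1 := aux_pwa_le a c y i
  have h2 : a i ⬝ᵥ x - a i ⬝ᵥ y ≤ (∑ j, |a i j|) * δ := by
    rw [← dotProduct_sub, dotProduct, Finset.sum_mul]
    apply Finset.sum_le_sum
    intro j _
    calc a i j * (x - y) j ≤ |a i j * (x - y) j| := le_abs_self _
      _ = |a i j| * |x j - y j| := by rw [abs_mul]; rfl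
      _ ≤ _ := by gcongr; exact hδ j
  by_cases hn : Nonempty (Fin n)
  · obtain ⟨j⟩ := hn
    have hd : 0 ≤ δ := (abs_nonneg _).trans (hδ j)
    have h3 : (∑ j, |a i j|) ≤ ∑ i, ∑ j, |a i j| :=
      Finset.single_le_sum (f := fun i => ∑ j, |a i j|)
        (fun _ _ => Finset.sum_nonneg fun _ _ => abs_nonneg _) (Finset.mem_univ i)
    have h4 := mul_le_mul_of_nonneg_right h3 hd
    linarith
  · have : IsEmpty (Fin n) := not_nonempty_iff.mp hn
    have hxy : x = y := Subsingleton.elim _ _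
    subst hxy
    simp only [Finset.univ_eq_empty, Finset.sum_empty, Finset.sum_const_zero, zero_mul, add_zero]
    exact h1

/-- Value at an orthogonally diagonalised matrix. -/
theorem aux_theta_diag {n p : ℕ} [NeZero p]
    (a : Fin p → Fin n → ℝ) (c : Fin p → ℝ)
    (hsym : ∀ (σ : Equiv.Perm (Fin n)) (x : Fin n → ℝ), pwa a c (x ∘ σ) = pwa a c x)
    (U : Matrix (Fin n) (Fin n) ℝ) (hU : Uᵀ * U = 1) (d : Fin n → ℝ) :
    pwa a c (lamVec (U * diagonal d * Uᵀ)) = pwa a c d := by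
  have hh : (U * diagonal d * Uᵀ).IsHermitian := by
    rw [Matrix.IsHermitian, conjTranspose_eq_transpose_of_trivial]
    simp [Matrix.mul_assoc]
  have e1 : lamVec (U * diagonal d * Uᵀ) =
      hh.eigenvalues ∘ (Fin.revPerm.trans (Tuple.sort hh.eigenvalues)) := by
    rw [lamVec, dif_pos hh]; rfl
  have e2 : Multiset.map hh.eigenvalues Finset.univ.val = Multiset.map d Finset.univ.val := by
    have r1 := hh.roots_charpoly_eq_eigenvalues
    have r2 : (U * diagonal d * Uᵀ).charpoly = (diagonal d).charpoly := by
      rw [charpoly_mul_comm, ← Matrix.mul_assoc, hU, Matrix.one_mul]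
    rw [r2, charpoly_diagonal, Polynomial.roots_prod] at r1
    · simp only [Polynomial.roots_X_sub_C] at r1
      rw [Multiset.bind_singleton] at r1
      rw [r1]; rfl
    · exact Finset.prod_ne_zero_iff.mpr fun i _ => Polynomial.X_sub_C_ne_zero _
  obtain ⟨σ, hσ⟩ := aux_perm_of_multiset _ _ e2
  rw [e1, hsym, hσ, hsym]

/-- Spectral theorem. -/
theorem aux_spectral {n : ℕ} (X : Matrix (Fin n) (Fin n) ℝ) (hX : X.IsSymm) :
    ∃ (U : Matrix (Fin n) (Fin n) ℝ) (d : Fin n → ℝ), Uᵀ * U = 1 ∧ X = U * diagonal d * Uᵀ := by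
  have hh : X.IsHermitian := by
    rw [Matrix.IsHermitian, conjTranspose_eq_transpose_of_trivial]; exact hX
  refine ⟨hh.eigenvectorUnitary, hh.eigenvalues, ?_, ?_⟩
  · have := Unitary.coe_star_mul_self hh.eigenvectorUnitary
    rwa [star_eq_conjTranspose, conjTranspose_eq_transpose_of_trivial] at this
  · have := hh.spectral_theorem
    rw [Unitary.conjStarAlgAut_apply, star_eq_conjTranspose,
      conjTranspose_eq_transpose_of_trivial] at this
    exact this

/-- Schur type inequality. -/
theorem aux_schur {n p : ℕ} [NeZero p]
    (a : Fin p → Fin n → ℝ) (c : Fin p → ℝ)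
    (hsym : ∀ (σ : Equiv.Perm (Fin n)) (x : Fin n → ℝ), pwa a c (x ∘ σ) = pwa a c x)
    (X : Matrix (Fin n) (Fin n) ℝ) (hX : X.IsSymm) :
    pwa a c (fun i => X i i) ≤ pwa a c (lamVec X) := by
  obtain ⟨U, d, hU, rfl⟩ := aux_spectral X hX
  rw [aux_theta_diag a c hsym U hU]
  have hU' : U * Uᵀ = 1 := mul_eq_one_comm.mp hU
  have hds : (Matrix.of fun i j => U i j ^ 2 : Matrix (Fin n) (Fin n) ℝ) ∈
      doublyStochastic ℝ (Fin n) := by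
    rw [mem_doublyStochastic_iff_sum]
    refine ⟨fun i j => by simpa using sq_nonneg _, fun i => ?_, fun j => ?_⟩
    · have := congrFun (congrFun hU' i) i
      simpa [Matrix.mul_apply, sq] using this
    · have := congrFun (congrFun hU j) j
      simpa [Matrix.mul_apply, sq] using this
  obtain ⟨w, hw0, hw1, hw2⟩ := exists_eq_sum_perm_of_mem_doublyStochastic hds
  have hd : (fun i => (U * diagonal d * Uᵀ) i i) = ∑ σ, w σ • (d ∘ (σ : Equiv.Perm (Fin n))) := by
    funext i
    have h1 : (U * diagonal d * Uᵀ) i i = ∑ j, U i j ^ 2 * d j := by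
      rw [Matrix.mul_apply]
      apply Finset.sum_congr rfl
      intro j _
      rw [Matrix.mul_diagonal, transpose_apply]; ring
    rw [h1]
    have h2 : ∀ j, U i j ^ 2 = ∑ σ : Equiv.Perm (Fin n), w σ * (σ.permMatrix ℝ) i j := by
      intro j
      have := congrFun (congrFun hw2 i) j
      rw [Matrix.sum_apply] at this
      simpa using this.symm
    simp only [h2, Finset.sum_mul, Finset.sum_apply, Pi.smul_apply, smul_eq_mul, Function.comp]
    rw [Finset.sum_comm]
    apply Finset.sum_congr rfl
    intro σ _
    simp [Equiv.Perm.permMatrix, PEquiv.toMatrix_apply, Equiv.toPEquiv_apply]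
  rw [hd]
  apply ciSup_le
  intro i
  have h3 : a i ⬝ᵥ (∑ σ, w σ • (d ∘ (σ : Equiv.Perm (Fin n)))) - c i =
      ∑ σ : Equiv.Perm (Fin n), w σ * (a i ⬝ᵥ (d ∘ σ) - c i) := by
    rw [dotProduct_sum]
    simp only [mul_sub, Finset.sum_sub_distrib, ← Finset.sum_mul, hw1, one_mul, dotProduct_smul,
      smul_eq_mul]
  rw [h3]
  calc _ ≤ ∑ σ : Equiv.Perm (Fin n), w σ * pwa a c d := by
        apply Finset.sum_le_sum
        intro σ _
        apply mul_le_mul_of_nonneg_left _ (hw0 σ)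
        rw [← hsym σ d]
        exact aux_pwa_le a c _ i
    _ = _ := by rw [← Finset.sum_mul, hw1, one_mul]

theorem aux_symm_conj {n : ℕ} {X : Matrix (Fin n) (Fin n) ℝ} (hX : X.IsSymm)
    (V : Matrix (Fin n) (Fin n) ℝ) : (Vᵀ * X * V).IsSymm := by
  have hX' : Xᵀ = X := hX
  rw [Matrix.IsSymm]; simp [Matrix.mul_assoc, hX']

/-- Orthogonal invariance. -/
theorem aux_inv {n p : ℕ} [NeZero p]
    (a : Fin p → Fin n → ℝ) (c : Fin p → ℝ)
    (hsym : ∀ (σ : Equiv.Perm (Fin n)) (x : Fin n → ℝ), pwa a c (x ∘ σ) = pwa a c x)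
    (X : Matrix (Fin n) (Fin n) ℝ) (hX : X.IsSymm)
    (Q : Matrix (Fin n) (Fin n) ℝ) (hQ : Qᵀ * Q = 1) :
    pwa a c (lamVec (Qᵀ * X * Q)) = pwa a c (lamVec X) := by
  obtain ⟨U, d, hU, rfl⟩ := aux_spectral X hX
  have hQ' : Q * Qᵀ = 1 := mul_eq_one_comm.mp hQ
  rw [aux_theta_diag a c hsym U hU]
  have : Qᵀ * (U * diagonal d * Uᵀ) * Q = (Qᵀ * U) * diagonal d * (Qᵀ * U)ᵀ := by
    simp [Matrix.mul_assoc]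
  rw [this, aux_theta_diag a c hsym]
  rw [transpose_mul, transpose_transpose, Matrix.mul_assoc, ← Matrix.mul_assoc Q, hQ',
    Matrix.one_mul, hU]

theorem aux_lip {n p : ℕ} [NeZero p]
    (a : Fin p → Fin n → ℝ) (c : Fin p → ℝ)
    (hsym : ∀ (σ : Equiv.Perm (Fin n)) (x : Fin n → ℝ), pwa a c (x ∘ σ) = pwa a c x)
    (X Z : Matrix (Fin n) (Fin n) ℝ) (hX : X.IsSymm) (hZ : Z.IsSymm) :
    |pwa a c (lamVec X) - pwa a c (lamVec Z)| ≤
      (∑ i, ∑ j, |a i j|) * ∑ j, ∑ k, |X j k - Z j k| := by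
  have main : ∀ X Z : Matrix (Fin n) (Fin n) ℝ, X.IsSymm → Z.IsSymm →
      pwa a c (lamVec X) ≤ pwa a c (lamVec Z) +
      (∑ i, ∑ j, |a i j|) * ∑ j, ∑ k, |X j k - Z j k| := by
    intro X Z hX hZ
    obtain ⟨V, d, hV, hXd⟩ := aux_spectral X hX
    have hV' : V * Vᵀ = 1 := mul_eq_one_comm.mp hV
    have hd : Vᵀ * X * V = diagonal d := by
      rw [hXd]
      calc Vᵀ * (V * diagonal d * Vᵀ) * V = (Vᵀ * V) * diagonal d * (Vᵀ * V) := by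
            simp only [Matrix.mul_assoc]
        _ = _ := by simp [hV]
    have h1 : pwa a c (lamVec X) = pwa a c d := by rw [hXd, aux_theta_diag a c hsym V hV]
    have h2 : pwa a c (fun i => (Vᵀ * Z * V) i i) ≤ pwa a c (lamVec Z) := by
      rw [← aux_inv a c hsym Z hZ V hV]
      exact aux_schur a c hsym _ (aux_symm_conj hZ V)
    have hVle : ∀ i j, |V i j| ≤ 1 := by
      intro i j
      have := congrFun (congrFun hV j) j
      simp only [Matrix.mul_apply, transpose_apply, one_apply_eq] at this
      have h4 : V i j * V i j ≤ ∑ i, V i j * V i j :=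
        Finset.single_le_sum (f := fun i => V i j * V i j)
          (fun _ _ => mul_self_nonneg _) (Finset.mem_univ i)
      rw [this] at h4
      exact abs_le_one_iff_mul_self_le_one.mpr h4
    have h3 := aux_pwa_lip a c d (fun i => (Vᵀ * Z * V) i i) (∑ j, ∑ k, |X j k - Z j k|) (by
      intro i
      have e : d i - (Vᵀ * Z * V) i i = (Vᵀ * (X - Z) * V) i i := by
        rw [Matrix.mul_sub, Matrix.sub_mul, hd]; simp
      rw [e, Matrix.mul_apply]
      simp only [Matrix.mul_apply, Finset.sum_mul]
      rw [Finset.sum_comm]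
      refine (Finset.abs_sum_le_sum_abs _ _).trans (Finset.sum_le_sum fun j _ => ?_)
      refine (Finset.abs_sum_le_sum_abs _ _).trans (Finset.sum_le_sum fun k _ => ?_)
      rw [abs_mul, abs_mul, transpose_apply, Matrix.sub_apply]
      calc |V j i| * |X j k - Z j k| * |V k i| ≤ 1 * |X j k - Z j k| * 1 := by
            gcongr
            · exact hVle _ _
            · exact hVle _ _
        _ = _ := by ring)
    linarith
  have A := main X Z hX hZ
  have B := main Z X hZ hX
  simp only [abs_sub_comm (Z _ _)] at B
  rw [abs_le]; constructor <;> linarith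


/-! ### Second-order expansions -/

/-- `f t = a + t b + t² c + o(t²)` as `t ↓ 0`. -/
def E2 (f : ℝ → ℝ) (a b c : ℝ) : Prop :=
  Tendsto (fun t => (f t - (a + t * b)) / t ^ 2) (𝓝[>] (0:ℝ)) (𝓝 c)

theorem aux_id_tendsto : Tendsto (fun t : ℝ => t) (𝓝[>] (0:ℝ)) (𝓝 0) :=
  tendsto_id.mono_left nhdsWithin_le_nhds

theorem E2.mul {f g : ℝ → ℝ} {a b c a' b' c' : ℝ} (hf : E2 f a b c) (hg : E2 g a' b' c') :
    E2 (fun t => f t * g t) (a * a') (a * b' + b * a') (a * c' + b * b' + c * a') := by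
  unfold E2 at *
  set u := fun t => (f t - (a + t * b)) / t ^ 2
  set v := fun t => (g t - (a' + t * b')) / t ^ 2
  have key : Tendsto (fun t => a * v t + b * b' + u t * a' + t * (b * v t + u t * b') +
      t ^ 2 * (u t * v t)) (𝓝[>] (0:ℝ))
      (𝓝 (a * c' + b * b' + c * a' + 0 * (b * c' + c * b') + 0 ^ 2 * (c * c'))) :=
    (((hg.const_mul a).add_const _).add (hf.mul_const _)).add
      (aux_id_tendsto.mul ((hg.const_mul b).add (hf.mul_const b'))) |>.add
      ((aux_id_tendsto.pow 2).mul (hf.mul hg))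
  have e0 : a * c' + b * b' + c * a' + 0 * (b * c' + c * b') + 0 ^ 2 * (c * c') =
    a * c' + b * b' + c * a' := by ring
  rw [e0] at key
  refine key.congr' ?_
  filter_upwards [self_mem_nhdsWithin] with t ht
  have ht' : t ≠ 0 := ne_of_gt ht
  have hu : f t = a + t * b + t ^ 2 * u t := by simp only [u]; field_simp; ring
  have hv : g t = a' + t * b' + t ^ 2 * v t := by simp only [v]; field_simp; ring
  rw [hu, hv]
  field_simp
  ring

theorem E2.add {f g : ℝ → ℝ} {a b c a' b' c' : ℝ} (hf : E2 f a b c) (hg : E2 g a' b' c') :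
    E2 (fun t => f t + g t) (a + a') (b + b') (c + c') := by
  unfold E2 at *
  refine (hf.add hg).congr fun t => ?_
  ring

theorem E2.poly (a b c : ℝ) : E2 (fun t => a + t * b + t ^ 2 * c) a b c := by
  unfold E2
  refine (tendsto_const_nhds (x := c)).congr' ?_
  filter_upwards [self_mem_nhdsWithin] with t ht
  have ht' : t ≠ 0 := ne_of_gt ht
  field_simp; ring

theorem E2.congr {f g : ℝ → ℝ} {a b c : ℝ} (hf : E2 f a b c) (h : f =ᶠ[𝓝[>] (0:ℝ)] g) :
    E2 g a b c := by
  unfold E2 at *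
  refine hf.congr' ?_
  filter_upwards [h] with t ht
  rw [ht]

theorem E2.const (a : ℝ) : E2 (fun _ => a) a 0 0 := by
  have := E2.poly a 0 0
  simpa using this

theorem E2.sum {ι : Type*} (s : Finset ι) {f : ι → ℝ → ℝ} {a b c : ι → ℝ}
    (h : ∀ i, E2 (f i) (a i) (b i) (c i)) :
    E2 (fun t => ∑ i ∈ s, f i t) (∑ i ∈ s, a i) (∑ i ∈ s, b i) (∑ i ∈ s, c i) := by
  induction s using Finset.induction_on with
  | empty => simpa using E2.const 0
  | insert i s hi ih =>
    simp only [Finset.sum_insert hi]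
    exact (h i).add ih

/-- substitution `t ↦ t²`. -/
theorem E2.sq {f : ℝ → ℝ} {a b c : ℝ} (h : E2 f a b c) : E2 (fun t => f (t ^ 2)) a 0 b := by
  unfold E2 at *
  have hs : Tendsto (fun t : ℝ => t ^ 2) (𝓝[>] (0:ℝ)) (𝓝[>] (0:ℝ)) := by
    rw [tendsto_nhdsWithin_iff]
    constructor
    · simpa using aux_id_tendsto.pow 2
    · filter_upwards [self_mem_nhdsWithin] with t ht
      exact pow_pos (mem_Ioi.mp ht) 2
  have h1 := h.comp hs
  have h2 := ((aux_id_tendsto.pow 2).mul h1).const_add b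
  simp only [ne_eq, OfNat.ofNat_ne_zero, not_false_eq_true, zero_pow, zero_mul, add_zero] at h2
  refine h2.congr' ?_
  filter_upwards [self_mem_nhdsWithin] with t ht
  have ht' : t ≠ 0 := ne_of_gt ht
  simp only [Function.comp]
  field_simp
  ring

theorem E2.unique {f : ℝ → ℝ} {a b c c' : ℝ} (h : E2 f a b c) (h' : E2 f a b c') : c = c' :=
  tendsto_nhds_unique h h'

/-- from the value expansion to the zeroth limit. -/
theorem E2.tendsto0 {f : ℝ → ℝ} {a b c : ℝ} (h : E2 f a b c) :
    Tendsto f (𝓝[>] (0:ℝ)) (𝓝 a) := by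
  have h2 := ((aux_id_tendsto.pow 2).mul h).add ((aux_id_tendsto.mul_const b).const_add a)
  simp only [ne_eq, OfNat.ofNat_ne_zero, not_false_eq_true, zero_pow, zero_mul, add_zero,
    zero_add] at h2
  refine h2.congr' ?_
  filter_upwards [self_mem_nhdsWithin] with t ht
  have ht' : t ≠ 0 := ne_of_gt ht
  field_simp
  ring

theorem E2.tendsto1 {f : ℝ → ℝ} {a b c : ℝ} (h : E2 f a b c) :
    Tendsto (fun t => (f t - a) / t) (𝓝[>] (0:ℝ)) (𝓝 b) := by
  have h2 := (aux_id_tendsto.mul h).const_add b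
  simp only [zero_mul, add_zero] at h2
  refine h2.congr' ?_
  filter_upwards [self_mem_nhdsWithin] with t ht
  have ht' : t ≠ 0 := ne_of_gt ht
  field_simp
  ring

/-- entrywise second-order expansion of a matrix path. -/
def EM {n : ℕ} (F : ℝ → Matrix (Fin n) (Fin n) ℝ) (A B C : Matrix (Fin n) (Fin n) ℝ) : Prop :=
  ∀ i j, E2 (fun t => F t i j) (A i j) (B i j) (C i j)

theorem EM.mul {n : ℕ} {F G : ℝ → Matrix (Fin n) (Fin n) ℝ}
    {A B C A' B' C' : Matrix (Fin n) (Fin n) ℝ} (hF : EM F A B C) (hG : EM G A' B' C') :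
    EM (fun t => F t * G t) (A * A') (A * B' + B * A') (A * C' + B * B' + C * A') := by
  intro i j
  have := E2.sum Finset.univ fun k => (hF i k).mul (hG k j)
  simpa only [Matrix.mul_apply, Matrix.add_apply, Finset.sum_add_distrib] using this

theorem EM.transpose {n : ℕ} {F : ℝ → Matrix (Fin n) (Fin n) ℝ}
    {A B C : Matrix (Fin n) (Fin n) ℝ} (hF : EM F A B C) :
    EM (fun t => (F t)ᵀ) Aᵀ Bᵀ Cᵀ := fun i j => hF j i

theorem EM.poly {n : ℕ} (A B C : Matrix (Fin n) (Fin n) ℝ) :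
    EM (fun t => A + t • B + t ^ 2 • C) A B C := fun i j => by
  simpa using E2.poly (A i j) (B i j) (C i j)

theorem EM.sq {n : ℕ} {F : ℝ → Matrix (Fin n) (Fin n) ℝ}
    {A B C : Matrix (Fin n) (Fin n) ℝ} (hF : EM F A B C) :
    EM (fun t => F (t ^ 2)) A 0 B := fun i j => (hF i j).sq

theorem EM.conj {n : ℕ} {F Q : ℝ → Matrix (Fin n) (Fin n) ℝ}
    {A B C K L : Matrix (Fin n) (Fin n) ℝ} (hF : EM F A B C) (hQ : EM Q 1 K L) :
    EM (fun t => (Q t)ᵀ * F t * Q t) A (B + A * K + Kᵀ * A)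
      (C + B * K + Kᵀ * B + A * L + Lᵀ * A + Kᵀ * A * K) := by
  have := ((hQ.transpose.mul hF).mul hQ)
  convert this using 1
  · simp
  · simp only [transpose_one]; noncomm_ring
  · simp only [transpose_one]; noncomm_ring

section expo
attribute [local instance] Matrix.linftyOpNormedRing Matrix.linftyOpNormedAlgebra

/-- The curve `exp (tK)`. -/
theorem aux_exp {n : ℕ} (K : Matrix (Fin n) (Fin n) ℝ) (hK : Kᵀ = -K) :
    ∃ Q : ℝ → Matrix (Fin n) (Fin n) ℝ, (∀ t, (Q t)ᵀ * Q t = 1) ∧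
      EM Q 1 K ((1/2 : ℝ) • (K * K)) := by
  refine ⟨fun t => NormedSpace.exp (t • K), fun t => ?_, ?_⟩
  · rw [← Matrix.exp_transpose, transpose_smul, hK, smul_neg, Matrix.exp_neg]
    exact Matrix.nonsing_inv_mul _ ((Matrix.isUnit_iff_isUnit_det _).mp (Matrix.isUnit_exp _))
  · have hO := (NormedSpace.exp_hasFPowerSeriesAt_zero (𝕂 := ℝ)
      (𝔸 := Matrix (Fin n) (Fin n) ℝ)).isBigO_sub_partialSum_pow 3
    have hlim : Tendsto (fun t : ℝ => t • K) (𝓝[>] (0:ℝ)) (𝓝 0) := by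
      have := aux_id_tendsto.smul_const K
      simpa using this
    have hO2 := hO.comp_tendsto hlim
    have hO3 : (fun t : ℝ => NormedSpace.exp (t • K) - (1 + t • K + t ^ 2 • ((1/2 : ℝ) • (K * K))))
        =O[𝓝[>] (0:ℝ)] fun t => t ^ 3 := by
      refine Asymptotics.IsBigO.trans (Asymptotics.IsBigO.congr_left hO2 ?_)
        (g := fun t : ℝ => ‖t • K‖ ^ 3) ?_
      · intro t
        simp only [Function.comp, FormalMultilinearSeries.partialSum, Finset.sum_range_succ,
          Finset.sum_range_zero, NormedSpace.expSeries_apply_eq, zero_add]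
        simp [Nat.factorial, pow_two, smul_smul]
        rw [mul_comm (2⁻¹ : ℝ)]
        rfl
      · apply Asymptotics.IsBigO.of_bound (‖K‖ ^ 3)
        filter_upwards with t
        rw [norm_smul]
        simp only [norm_pow, norm_mul, norm_norm]
        rw [mul_pow, mul_comm]
    intro i j
    unfold E2
    rw [← tendsto_sub_nhds_zero_iff]
    have hsm : (fun t : ℝ => t ^ 3) =o[𝓝[>] (0:ℝ)] fun t => t ^ 2 :=
      (Asymptotics.isLittleO_pow_pow (by norm_num)).mono nhdsWithin_le_nhds
    have hent : (fun t : ℝ => (NormedSpace.exp (t • K) -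
        (1 + t • K + t ^ 2 • ((1/2 : ℝ) • (K * K)))) i j) =O[𝓝[>] (0:ℝ)] fun t => t ^ 3 := by
      refine Asymptotics.IsBigO.trans ?_ hO3
      apply Asymptotics.IsBigO.of_bound 1
      filter_upwards with t
      rw [one_mul]
      set M := NormedSpace.exp (t • K) - (1 + t • K + t ^ 2 • ((1/2 : ℝ) • (K * K)))
      rw [Matrix.linfty_opNorm_def]
      have h1 : ‖M i j‖₊ ≤ ∑ j, ‖M i j‖₊ :=
        Finset.single_le_sum (f := fun j => ‖M i j‖₊) (fun _ _ => zero_le) (Finset.mem_univ j)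
      have h2 := Finset.le_sup (f := fun i => ∑ j, ‖M i j‖₊) (Finset.mem_univ i)
      exact_mod_cast h1.trans h2
    refine (hent.trans_isLittleO hsm).tendsto_div_nhds_zero.congr' ?_
    filter_upwards [self_mem_nhdsWithin] with t ht
    have ht' : t ≠ 0 := ne_of_gt ht
    simp only [Matrix.sub_apply, Matrix.add_apply, Matrix.smul_apply, smul_eq_mul]
    field_simp
    ring

end expo


/-! ### Maxima of quadratics, simultaneous diagonalisation, pseudo-inverses -/

theorem aux_two_quad (α β γ α' β' γ' : ℝ) :
    (∀ᶠ t in 𝓝[>] (0:ℝ), α + t * β + t ^ 2 * γ ≤ α' + t * β' + t ^ 2 * γ') ∨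
    (∀ᶠ t in 𝓝[>] (0:ℝ), α' + t * β' + t ^ 2 * γ' ≤ α + t * β + t ^ 2 * γ) := by
  have key : ∀ α β γ α' β' γ' : ℝ, (α < α' ∨ (α = α' ∧ (β < β' ∨ (β = β' ∧ γ ≤ γ')))) →
      ∀ᶠ t in 𝓝[>] (0:ℝ), α + t * β + t ^ 2 * γ ≤ α' + t * β' + t ^ 2 * γ' := by
    intro α β γ α' β' γ' h
    rcases h with h | ⟨rfl, h | ⟨rfl, h⟩⟩
    · have := (E2.poly α β γ).tendsto0.eventually_lt (E2.poly α' β' γ').tendsto0 h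
      filter_upwards [this] with t ht using ht.le
    · have := (E2.poly α β γ).tendsto1.eventually_lt (E2.poly α β' γ').tendsto1 h
      filter_upwards [this, self_mem_nhdsWithin] with t ht ht0
      have := (div_lt_div_iff_of_pos_right (mem_Ioi.mp ht0)).mp ht
      linarith
    · filter_upwards with t
      have := mul_le_mul_of_nonneg_left h (sq_nonneg t)
      linarith
  rcases lt_trichotomy α α' with h | h | h
  · exact Or.inl (key _ _ _ _ _ _ (Or.inl h))
  · rcases lt_trichotomy β β' with h' | h' | h'
    · exact Or.inl (key _ _ _ _ _ _ (Or.inr ⟨h, Or.inl h'⟩))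
    · rcases le_total γ γ' with h'' | h''
      · exact Or.inl (key _ _ _ _ _ _ (Or.inr ⟨h, Or.inr ⟨h', h''⟩⟩))
      · exact Or.inr (key _ _ _ _ _ _ (Or.inr ⟨h.symm, Or.inr ⟨h'.symm, h''⟩⟩))
    · exact Or.inr (key _ _ _ _ _ _ (Or.inr ⟨h.symm, Or.inl h'⟩))
  · exact Or.inr (key _ _ _ _ _ _ (Or.inl h))

theorem aux_quad_max {ι : Type*} (α β γ : ι → ℝ) (s : Finset ι) (hs : s.Nonempty) :
    ∃ i ∈ s, ∀ j ∈ s, ∀ᶠ t in 𝓝[>] (0:ℝ),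
      α j + t * β j + t ^ 2 * γ j ≤ α i + t * β i + t ^ 2 * γ i := by
  induction hs using Finset.Nonempty.cons_induction with
  | singleton i => exact ⟨i, by simp, by simp⟩
  | cons k s hk hs ih =>
    obtain ⟨i, hi, hmax⟩ := ih
    rcases aux_two_quad (α k) (β k) (γ k) (α i) (β i) (γ i) with h | h
    · refine ⟨i, by simp [hi], fun j hj => ?_⟩
      rw [Finset.mem_cons] at hj
      rcases hj with rfl | hj
      · exact h
      · exact hmax j hj
    · refine ⟨k, by simp, fun j hj => ?_⟩
      rw [Finset.mem_cons] at hj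
      rcases hj with rfl | hj
      · exact Eventually.of_forall fun t => le_rfl
      · filter_upwards [h, hmax j hj] with t h1 h2 using h2.trans h1

theorem aux_pwa_expand {n p : ℕ} [NeZero p] (a : Fin p → Fin n → ℝ) (c : Fin p → ℝ)
    (x y z : Fin n → ℝ) : ∃ i, (fun t : ℝ => pwa a c (x + t • y + t ^ 2 • z)) =ᶠ[𝓝[>] (0:ℝ)]
      fun t => (a i ⬝ᵥ x - c i) + t * (a i ⬝ᵥ y) + t ^ 2 * (a i ⬝ᵥ z) := by
  obtain ⟨i, -, hi⟩ := aux_quad_max (fun i => a i ⬝ᵥ x - c i) (fun i => a i ⬝ᵥ y)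
    (fun i => a i ⬝ᵥ z) Finset.univ Finset.univ_nonempty
  refine ⟨i, ?_⟩
  have hall := (eventually_all (l := 𝓝[>] (0:ℝ))).mpr fun j => hi j (Finset.mem_univ j)
  filter_upwards [hall] with t ht
  have e : ∀ j, a j ⬝ᵥ (x + t • y + t ^ 2 • z) - c j =
      (a j ⬝ᵥ x - c j) + t * (a j ⬝ᵥ y) + t ^ 2 * (a j ⬝ᵥ z) := by
    intro j
    simp only [dotProduct_add, dotProduct_smul, smul_eq_mul]; ring
  apply le_antisymm
  · apply ciSup_le
    intro j
    rw [e j]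
    exact ht j
  · rw [← e i]
    exact aux_pwa_le a c _ i

theorem aux_simdiag {n m : ℕ} (T : Fin m → Matrix (Fin n) (Fin n) ℝ) (hT : ∀ k, (T k).IsSymm)
    (hc : ∀ k l, T k * T l = T l * T k) :
    ∃ (V : Matrix (Fin n) (Fin n) ℝ) (d : Fin m → Fin n → ℝ), Vᵀ * V = 1 ∧
      ∀ k, T k = V * diagonal (d k) * Vᵀ := by
  have hh : ∀ k, (T k).IsHermitian := fun k => by
    rw [Matrix.IsHermitian, conjTranspose_eq_transpose_of_trivial]; exact hT k
  let S : Fin m → (EuclideanSpace ℝ (Fin n) →ₗ[ℝ] EuclideanSpace ℝ (Fin n)) :=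
    fun k => Matrix.toEuclideanLin (T k)
  have hS : ∀ k, (S k).IsSymmetric := fun k => isSymmetric_toEuclideanLin_iff.mpr (hh k)
  have hSc : Pairwise (Function.onFun Commute S) := by
    intro k l _
    refine LinearMap.ext fun x => ?_
    simp only [S, Module.End.mul_apply, toLpLin_apply, mulVec_mulVec, hc k l]
  let N : (Fin m → ℝ) → Submodule ℝ (EuclideanSpace ℝ (Fin n)) :=
    fun α => ⨅ j, Module.End.eigenspace (S j) (α j)
  have hI : DirectSum.IsInternal N :=
    LinearMap.IsSymmetric.directSum_isInternal_of_pairwise_commute hS hSc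
  have hO : OrthogonalFamily ℝ (fun γ => N γ) fun γ => (N γ).subtypeₗᵢ :=
    LinearMap.IsSymmetric.orthogonalFamily_iInf_eigenspaces hS
  have hfin : {i | N i ≠ ⊥}.Finite :=
    WellFoundedGT.finite_ne_bot_of_iSupIndep hI.submodule_iSupIndep
  have : Fintype {i // N i ≠ ⊥} := hfin.fintype
  have hI' : DirectSum.IsInternal fun i : {i // N i ≠ ⊥} => N i :=
    DirectSum.isInternal_ne_bot_iff.mpr hI
  have hO' : OrthogonalFamily ℝ (fun γ : {i // N i ≠ ⊥} => N γ) fun γ => (N γ).subtypeₗᵢ :=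
    hO.comp Subtype.val_injective
  have hn : Module.finrank ℝ (EuclideanSpace ℝ (Fin n)) = n := by simp
  let b := hI'.subordinateOrthonormalBasis hn hO'
  let ix := fun a => hI'.subordinateOrthonormalBasisIndex hn a hO'
  have hb : ∀ a, b a ∈ N (ix a) := fun a => hI'.subordinateOrthonormalBasis_subordinate hn a hO'
  have hb2 : ∀ k a, T k *ᵥ (b a).ofLp = (ix a).1 k • (b a).ofLp := by
    intro k a
    have h1 := hb a
    simp only [N, Submodule.mem_iInf] at h1
    have h2 := Module.End.mem_eigenspace_iff.mp (h1 k)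
    have h3 := congrArg WithLp.ofLp h2
    simpa [S, toLpLin_apply] using h3
  let V : Matrix (Fin n) (Fin n) ℝ := Matrix.of fun i j => (b j).ofLp i
  have hV : Vᵀ * V = 1 := by
    ext i j
    have := orthonormal_iff_ite.mp b.orthonormal i j
    rw [Matrix.one_apply, ← this, Matrix.mul_apply]
    simp [V, PiLp.inner_apply, mul_comm]
  refine ⟨V, fun k a => (ix a).1 k, hV, fun k => ?_⟩
  have h1 : T k * V = V * diagonal (fun a => (ix a).1 k) := by
    ext i j
    rw [Matrix.mul_diagonal]
    have := congrFun (hb2 k j) i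
    simp only [mulVec, dotProduct, Pi.smul_apply, smul_eq_mul] at this
    rw [Matrix.mul_apply]
    simp only [V, Matrix.of_apply]
    rw [this, mul_comm]
  rw [← h1, Matrix.mul_assoc, mul_eq_one_comm.mp hV, Matrix.mul_one]

/-- The skew matrix solving `[A,K] = -(off-diagonal block part of B)` for diagonal `A`. -/
def KK {n : ℕ} (x : Fin n → ℝ) (B : Matrix (Fin n) (Fin n) ℝ) : Matrix (Fin n) (Fin n) ℝ :=
  Matrix.of fun i j => B i j / (x j - x i)

theorem KK_skew {n : ℕ} (x : Fin n → ℝ) (B : Matrix (Fin n) (Fin n) ℝ) (hB : B.IsSymm) :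
    (KK x B)ᵀ = - KK x B := by
  ext i j
  simp only [KK, transpose_apply, of_apply, Matrix.neg_apply]
  rw [hB.apply i j, ← neg_sub (x j) (x i), div_neg]

theorem KK_block {n : ℕ} (x : Fin n → ℝ) (B : Matrix (Fin n) (Fin n) ℝ) (i j : Fin n) :
    (B + diagonal x * KK x B - KK x B * diagonal x) i j = if x i = x j then B i j else 0 := by
  simp only [Matrix.sub_apply, Matrix.add_apply, diagonal_mul, mul_diagonal, KK, of_apply]
  split_ifs with h
  · simp [h]
  · have : x j - x i ≠ 0 := sub_ne_zero.mpr (Ne.symm h)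
    field_simp; ring

theorem KK_comm {n : ℕ} (x : Fin n → ℝ) (B : Matrix (Fin n) (Fin n) ℝ) :
    diagonal x * (B + diagonal x * KK x B - KK x B * diagonal x) =
    (B + diagonal x * KK x B - KK x B * diagonal x) * diagonal x := by
  ext i j
  rw [diagonal_mul, mul_diagonal, KK_block]
  split_ifs with h
  · rw [h, mul_comm]
  · simp

theorem KK_comm' {n : ℕ} (x s : Fin n → ℝ) (B : Matrix (Fin n) (Fin n) ℝ)
    (h : diagonal s * B = B * diagonal s) :
    diagonal s * KK x B = KK x B * diagonal s := by
  ext i j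
  have := congrFun (congrFun h i) j
  rw [diagonal_mul, mul_diagonal] at *
  simp only [KK, of_apply]
  rw [← mul_div_assoc, this]; ring

/-- Sylvester type lemma. -/
theorem aux_sylv {n : ℕ} (S A B : Matrix (Fin n) (Fin n) ℝ) (hS : S.IsSymm) (hA : A.IsSymm)
    (hB : B.IsSymm) (hSA : S * A = A * S) (hSB : S * B = B * S) :
    ∃ K : Matrix (Fin n) (Fin n) ℝ, Kᵀ = -K ∧ S * K = K * S ∧
      A * (B + A * K - K * A) = (B + A * K - K * A) * A := by
  obtain ⟨V, d, hV, hd⟩ := aux_simdiag ![S, A] (by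
    intro k; fin_cases k <;> simp [hS, hA]) (by
    intro k l; fin_cases k <;> fin_cases l <;> simp [hSA])
  have hV' : V * Vᵀ = 1 := mul_eq_one_comm.mp hV
  have hS' : S = V * diagonal (d 0) * Vᵀ := hd 0
  have hA' : A = V * diagonal (d 1) * Vᵀ := hd 1
  have cj : ∀ P R : Matrix (Fin n) (Fin n) ℝ, (V * P * Vᵀ) * (V * R * Vᵀ) = V * (P * R) * Vᵀ := by
    intro P R
    calc _ = V * P * (Vᵀ * V) * R * Vᵀ := by simp only [Matrix.mul_assoc]
      _ = _ := by rw [hV]; simp only [Matrix.mul_assoc, Matrix.one_mul]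
  obtain ⟨B', hB'⟩ : ∃ B', B' = Vᵀ * B * V := ⟨_, rfl⟩
  have hBs : B'.IsSymm := hB' ▸ aux_symm_conj hB V
  have hBB : B = V * B' * Vᵀ := by
    rw [hB']
    calc B = (V * Vᵀ) * B * (V * Vᵀ) := by simp [hV']
      _ = _ := by simp only [Matrix.mul_assoc]
  have inj : ∀ P R : Matrix (Fin n) (Fin n) ℝ, V * P * Vᵀ = V * R * Vᵀ → P = R := by
    intro P R h
    have h2 : ∀ P : Matrix (Fin n) (Fin n) ℝ, Vᵀ * (V * P * Vᵀ) * V = P := by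
      intro P
      calc _ = (Vᵀ * V) * P * (Vᵀ * V) := by simp only [Matrix.mul_assoc]
        _ = _ := by simp [hV]
    rw [← h2 P, h, h2]
  refine ⟨V * KK (d 1) B' * Vᵀ, ?_, ?_, ?_⟩
  · rw [transpose_mul, transpose_mul, transpose_transpose, KK_skew _ _ hBs]
    simp [Matrix.mul_assoc]
  · rw [hS', cj, cj, KK_comm']
    apply inj
    rw [← cj, ← cj B', ← hBB, ← hS', hSB]
  · rw [hA']
    conv_lhs => rw [hBB]
    conv_rhs => rw [hBB]
    rw [cj, cj]
    have e : V * B' * Vᵀ + V * (diagonal (d 1) * KK (d 1) B') * Vᵀ -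
        V * (KK (d 1) B' * diagonal (d 1)) * Vᵀ =
        V * (B' + diagonal (d 1) * KK (d 1) B' - KK (d 1) B' * diagonal (d 1)) * Vᵀ := by
      noncomm_ring
    rw [e, cj, cj, KK_comm]

theorem aux_mp_unique {n : ℕ} (A B C : Matrix (Fin n) (Fin n) ℝ)
    (hB : A * B * A = A ∧ B * A * B = B ∧ (A * B)ᵀ = A * B ∧ (B * A)ᵀ = B * A)
    (hC : A * C * A = A ∧ C * A * C = C ∧ (A * C)ᵀ = A * C ∧ (C * A)ᵀ = C * A) : B = C := by
  obtain ⟨b1, b2, b3, b4⟩ := hB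
  obtain ⟨c1, c2, c3, c4⟩ := hC
  have h1 : A * B = A * C := by
    calc A * B = (A * B)ᵀ := b3.symm
      _ = ((A * C) * (A * B))ᵀ := by rw [← Matrix.mul_assoc, c1]
      _ = (A * B) * (A * C) := by rw [transpose_mul, b3, c3]
      _ = A * C := by rw [← Matrix.mul_assoc, b1]
  have h2 : B * A = C * A := by
    calc B * A = (B * A)ᵀ := b4.symm
      _ = ((B * A) * (C * A))ᵀ := by
          rw [Matrix.mul_assoc B A (C * A), ← Matrix.mul_assoc A C A, c1]
      _ = (C * A) * (B * A) := by rw [transpose_mul, b4, c4]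
      _ = C * A := by rw [Matrix.mul_assoc C A (B * A), ← Matrix.mul_assoc A B A, b1]
  calc B = B * A * B := b2.symm
    _ = C * A * B := by rw [h2]
    _ = C * (A * B) := Matrix.mul_assoc _ _ _
    _ = C * A * C := by rw [h1, Matrix.mul_assoc]
    _ = C := c2

theorem aux_mpInv {n : ℕ} (U : Matrix (Fin n) (Fin n) ℝ) (hU : Uᵀ * U = 1) (d : Fin n → ℝ) :
    mpInv (U * diagonal d * Uᵀ) = U * diagonal (fun i => (d i)⁻¹) * Uᵀ := by
  have cj : ∀ P R : Matrix (Fin n) (Fin n) ℝ, (U * P * Uᵀ) * (U * R * Uᵀ) = U * (P * R) * Uᵀ := by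
    intro P R
    calc _ = U * P * (Uᵀ * U) * R * Uᵀ := by simp only [Matrix.mul_assoc]
      _ = _ := by rw [hU]; simp only [Matrix.mul_assoc, Matrix.one_mul]
  have tr : ∀ d : Fin n → ℝ, (U * diagonal d * Uᵀ)ᵀ = U * diagonal d * Uᵀ := by
    intro d; simp [Matrix.mul_assoc]
  obtain ⟨P, hP⟩ : ∃ P : Matrix (Fin n) (Fin n) ℝ → Prop, P = fun B =>
      (U * diagonal d * Uᵀ) * B * (U * diagonal d * Uᵀ) = (U * diagonal d * Uᵀ) ∧
      B * (U * diagonal d * Uᵀ) * B = B ∧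
      ((U * diagonal d * Uᵀ) * B)ᵀ = (U * diagonal d * Uᵀ) * B ∧
      (B * (U * diagonal d * Uᵀ))ᵀ = B * (U * diagonal d * Uᵀ) := ⟨_, rfl⟩
  have hspec : P (U * diagonal (fun i => (d i)⁻¹) * Uᵀ) := by
    rw [hP]
    refine ⟨?_, ?_, ?_, ?_⟩
    · simp only [cj, diagonal_mul_diagonal]
      congr 3; funext i
      exact mul_inv_mul_cancel (d i)
    · simp only [cj, diagonal_mul_diagonal]
      congr 3; funext i
      simpa using mul_inv_mul_cancel (d i)⁻¹
    · simp only [cj, diagonal_mul_diagonal, tr]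
    · simp only [cj, diagonal_mul_diagonal, tr]
  have h2 : P (Classical.epsilon P) := Classical.epsilon_spec ⟨_, hspec⟩
  have h3 : mpInv (U * diagonal d * Uᵀ) = Classical.epsilon P := by rw [hP]; rfl
  rw [← h3] at h2
  rw [hP] at h2 hspec
  exact aux_mp_unique _ _ _ h2 hspec


/-! ### Expansion of the spectral function along curves -/

theorem EM.symm_coeffs {n : ℕ} {F : ℝ → Matrix (Fin n) (Fin n) ℝ}
    {A B C : Matrix (Fin n) (Fin n) ℝ} (hF : EM F A B C) (hs : ∀ t, (F t).IsSymm) :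
    A.IsSymm ∧ B.IsSymm ∧ C.IsSymm := by
  have e : ∀ i j, (fun t => F t i j) = fun t => F t j i := fun i j =>
    funext fun t => (hs t).apply j i
  have hA : ∀ i j, A i j = A j i := fun i j => by
    have h1 := (hF i j).tendsto0
    rw [e i j] at h1
    exact tendsto_nhds_unique h1 (hF j i).tendsto0
  have hB : ∀ i j, B i j = B j i := fun i j => by
    have h1 := hF i j
    rw [e i j, hA i j] at h1
    exact tendsto_nhds_unique h1.tendsto1 (hF j i).tendsto1
  have hC : ∀ i j, C i j = C j i := fun i j => by
    have h1 := hF i j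
    rw [e i j, hA i j, hB i j] at h1
    exact h1.unique (hF j i)
  exact ⟨Matrix.IsSymm.ext fun i j => hA j i, Matrix.IsSymm.ext fun i j => hB j i,
    Matrix.IsSymm.ext fun i j => hC j i⟩

theorem aux_approx {n p : ℕ} [NeZero p]
    (a : Fin p → Fin n → ℝ) (c : Fin p → ℝ)
    (hsym : ∀ (σ : Equiv.Perm (Fin n)) (x : Fin n → ℝ), pwa a c (x ∘ σ) = pwa a c x)
    {F G : ℝ → Matrix (Fin n) (Fin n) ℝ} {A B C : Matrix (Fin n) (Fin n) ℝ}
    (hF : EM F A B C) (hG : EM G A B C) (hFs : ∀ t, (F t).IsSymm) (hGs : ∀ t, (G t).IsSymm)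
    {α β γ : ℝ} (h : E2 (fun t => pwa a c (lamVec (G t))) α β γ) :
    E2 (fun t => pwa a c (lamVec (F t))) α β γ := by
  have hz : Tendsto (fun t => (∑ i, ∑ j, |a i j|) * ∑ j, ∑ k, |(F t j k - G t j k) / t ^ 2|)
      (𝓝[>] (0:ℝ)) (𝓝 ((∑ i, ∑ j, |a i j|) * ∑ j : Fin n, ∑ k : Fin n, |C j k - C j k|)) := by
    refine Tendsto.const_mul _ (tendsto_finsetSum _ fun j _ => tendsto_finsetSum _ fun k _ => ?_)
    refine (((hF j k).sub (hG j k)).abs).congr fun t => ?_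
    congr 1; ring
  simp only [sub_self, abs_zero, Finset.sum_const_zero, mul_zero] at hz
  have hd : Tendsto (fun t => (pwa a c (lamVec (F t)) - pwa a c (lamVec (G t))) / t ^ 2)
      (𝓝[>] (0:ℝ)) (𝓝 0) := by
    refine squeeze_zero_norm (fun t => ?_) hz
    rw [Real.norm_eq_abs, abs_div]
    simp only [abs_div, ← Finset.sum_div, ← mul_div_assoc]
    exact div_le_div_of_nonneg_right (aux_lip a c hsym _ _ (hFs t) (hGs t)) (abs_nonneg _)
  have := hd.add h
  rw [zero_add] at this
  unfold E2
  refine this.congr fun t => ?_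
  ring

theorem aux_conjstep {n : ℕ} (F : ℝ → Matrix (Fin n) (Fin n) ℝ)
    (A B C K : Matrix (Fin n) (Fin n) ℝ) (hF : EM F A B C) (hK : Kᵀ = -K) :
    ∃ Q : ℝ → Matrix (Fin n) (Fin n) ℝ, (∀ t, (Q t)ᵀ * Q t = 1) ∧
      EM (fun t => (Q t)ᵀ * F t * Q t) A (B + A * K - K * A)
        (C + (B * K - K * B + (1/2 : ℝ) • (A * (K * K) + (K * K) * A) - K * A * K)) := by
  obtain ⟨Q, hQ, hE⟩ := aux_exp K hK
  refine ⟨Q, hQ, ?_⟩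
  have := hF.conj hE
  have hKK : (K * K)ᵀ = K * K := by rw [transpose_mul, hK]; simp
  rw [transpose_smul, hKK, hK] at this
  convert this using 1
  · noncomm_ring
  · simp only [Matrix.mul_smul, Matrix.smul_mul, smul_add]; noncomm_ring

theorem aux_conjstep2 {n : ℕ} (F : ℝ → Matrix (Fin n) (Fin n) ℝ)
    (A B C K : Matrix (Fin n) (Fin n) ℝ) (hF : EM F A B C) (hK : Kᵀ = -K) :
    ∃ Q : ℝ → Matrix (Fin n) (Fin n) ℝ, (∀ t, (Q t)ᵀ * Q t = 1) ∧
      EM (fun t => (Q t)ᵀ * F t * Q t) A B (C + A * K - K * A) := by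
  obtain ⟨Q, hQ, hE⟩ := aux_exp K hK
  refine ⟨fun t => Q (t ^ 2), fun t => hQ _, ?_⟩
  have := hF.conj hE.sq
  rw [hK] at this
  convert this using 1
  · simp
  · simp; noncomm_ring

/-- Expansion along a pencil of commuting matrices. -/
theorem aux_commuting {n p : ℕ} [NeZero p]
    (a : Fin p → Fin n → ℝ) (c : Fin p → ℝ)
    (hsym : ∀ (σ : Equiv.Perm (Fin n)) (x : Fin n → ℝ), pwa a c (x ∘ σ) = pwa a c x)
    (A B C : Matrix (Fin n) (Fin n) ℝ) (hA : A.IsSymm) (hB : B.IsSymm) (hC : C.IsSymm)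
    (hAB : A * B = B * A) (hAC : A * C = C * A) (hBC : B * C = C * B) :
    ∃ α β γ : ℝ, E2 (fun t => pwa a c (lamVec (A + t • B + t ^ 2 • C))) α β γ ∧
      (C = 0 → γ = 0) := by
  obtain ⟨V, d, hV, hd⟩ := aux_simdiag ![A, B, C] (by
    intro k; fin_cases k <;> simp [hA, hB, hC]) (by
    intro k l; fin_cases k <;> fin_cases l <;> simp [hAB, hAC, hBC])
  have h0 : A = V * diagonal (d 0) * Vᵀ := hd 0
  have h1 : B = V * diagonal (d 1) * Vᵀ := hd 1
  have h2 : C = V * diagonal (d 2) * Vᵀ := hd 2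
  obtain ⟨i, hi⟩ := aux_pwa_expand a c (d 0) (d 1) (d 2)
  refine ⟨_, _, _, (E2.poly _ _ _).congr (hi.symm.trans ?_), ?_⟩
  · filter_upwards with t
    have : A + t • B + t ^ 2 • C = V * diagonal (d 0 + t • d 1 + t ^ 2 • d 2) * Vᵀ := by
      rw [h0, h1, h2]
      have e : diagonal (d 0 + t • d 1 + t ^ 2 • d 2) =
          diagonal (d 0) + t • diagonal (d 1) + t ^ 2 • diagonal (d 2) := by
        rw [← diagonal_smul, ← diagonal_smul, diagonal_add, diagonal_add]; rfl
      rw [e]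
      simp only [Matrix.mul_add, Matrix.add_mul, Matrix.mul_smul, Matrix.smul_mul]
    rw [this, aux_theta_diag a c hsym V hV]
  · intro hC0
    have : diagonal (d 2) = 0 := by
      calc diagonal (d 2) = (Vᵀ * V) * diagonal (d 2) * (Vᵀ * V) := by simp [hV]
        _ = Vᵀ * (V * diagonal (d 2) * Vᵀ) * V := by simp only [Matrix.mul_assoc]
        _ = 0 := by rw [← h2, hC0]; simp
    have h3 : d 2 = 0 := by
      funext j
      have := congrFun (congrFun this j) j
      simpa using this
    rw [h3]; simp

/-- Existence of the second-order expansion along any curve. -/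
theorem aux_exists {n p : ℕ} [NeZero p]
    (a : Fin p → Fin n → ℝ) (c : Fin p → ℝ)
    (hsym : ∀ (σ : Equiv.Perm (Fin n)) (x : Fin n → ℝ), pwa a c (x ∘ σ) = pwa a c x)
    (F : ℝ → Matrix (Fin n) (Fin n) ℝ) (A B C : Matrix (Fin n) (Fin n) ℝ)
    (hF : EM F A B C) (hFs : ∀ t, (F t).IsSymm) :
    ∃ α β γ : ℝ, E2 (fun t => pwa a c (lamVec (F t))) α β γ := by
  obtain ⟨hA, hB, hC⟩ := hF.symm_coeffs hFs
  obtain ⟨K1, hK1, -, hc1⟩ := aux_sylv 1 A B (by simp [Matrix.IsSymm]) hA hB (by simp) (by simp)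
  obtain ⟨Q1, hQ1, hE1⟩ := aux_conjstep F A B C K1 hF hK1
  have hs1 : ∀ t, ((Q1 t)ᵀ * F t * Q1 t).IsSymm := fun t => aux_symm_conj (hFs t) _
  have ht1 : ∀ t, pwa a c (lamVec ((Q1 t)ᵀ * F t * Q1 t)) = pwa a c (lamVec (F t)) :=
    fun t => aux_inv a c hsym _ (hFs t) _ (hQ1 t)
  generalize B + A * K1 - K1 * A = B1 at *
  generalize C + (B * K1 - K1 * B + (1/2 : ℝ) • (A * (K1 * K1) + (K1 * K1) * A) - K1 * A * K1)
    = C1 at *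
  generalize hF1 : (fun t => (Q1 t)ᵀ * F t * Q1 t) = F1 at *
  have hF1' : ∀ t, (Q1 t)ᵀ * F t * Q1 t = F1 t := fun t => congrFun hF1 t
  simp only [hF1'] at hs1 ht1
  obtain ⟨-, hB1, hC1⟩ := hE1.symm_coeffs hs1
  obtain ⟨K2, hK2, -, hc2⟩ := aux_sylv 1 A C1 (by simp [Matrix.IsSymm]) hA hC1 (by simp) (by simp)
  obtain ⟨Q2, hQ2, hE2⟩ := aux_conjstep2 F1 A B1 C1 K2 hE1 hK2
  have hs2 : ∀ t, ((Q2 t)ᵀ * F1 t * Q2 t).IsSymm := fun t => aux_symm_conj (hs1 t) _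
  have ht2 : ∀ t, pwa a c (lamVec ((Q2 t)ᵀ * F1 t * Q2 t)) = pwa a c (lamVec (F1 t)) :=
    fun t => aux_inv a c hsym _ (hs1 t) _ (hQ2 t)
  generalize C1 + A * K2 - K2 * A = C2 at *
  generalize hF2 : (fun t => (Q2 t)ᵀ * F1 t * Q2 t) = F2 at *
  have hF2' : ∀ t, (Q2 t)ᵀ * F1 t * Q2 t = F2 t := fun t => congrFun hF2 t
  simp only [hF2'] at hs2 ht2
  obtain ⟨-, -, hC2⟩ := hE2.symm_coeffs hs2
  obtain ⟨K3, hK3, hcK, hc3⟩ := aux_sylv A B1 C2 hA hB1 hC2 hc1 hc2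
  obtain ⟨Q3, hQ3, hE3⟩ := aux_conjstep F2 A B1 C2 K3 hE2 hK3
  have hs3 : ∀ t, ((Q3 t)ᵀ * F2 t * Q3 t).IsSymm := fun t => aux_symm_conj (hs2 t) _
  have ht3 : ∀ t, pwa a c (lamVec ((Q3 t)ᵀ * F2 t * Q3 t)) = pwa a c (lamVec (F2 t)) :=
    fun t => aux_inv a c hsym _ (hs2 t) _ (hQ3 t)
  have e1 : B1 + A * K3 - K3 * A = B1 := by rw [hcK]; simp
  have e2 : C2 + (B1 * K3 - K3 * B1 + (1/2 : ℝ) • (A * (K3 * K3) + (K3 * K3) * A) - K3 * A * K3)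
      = C2 + B1 * K3 - K3 * B1 := by
    have f1 : K3 * K3 * A = K3 * A * K3 := by
      rw [Matrix.mul_assoc K3 K3 A, Matrix.mul_assoc K3 A K3, hcK]
    have f2 : A * (K3 * K3) = K3 * A * K3 := by rw [← Matrix.mul_assoc, hcK]
    rw [f1, f2, ← two_smul ℝ (K3 * A * K3), smul_smul]
    norm_num
    abel
  rw [e1, e2] at hE3
  obtain ⟨-, -, hC3⟩ := hE3.symm_coeffs hs3
  have hAC3 : A * (C2 + B1 * K3 - K3 * B1) = (C2 + B1 * K3 - K3 * B1) * A := by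
    have g1 : A * (B1 * K3) = B1 * K3 * A := by
      rw [← Matrix.mul_assoc, hc1, Matrix.mul_assoc, hcK, Matrix.mul_assoc]
    have g2 : A * (K3 * B1) = K3 * B1 * A := by
      rw [← Matrix.mul_assoc, hcK, Matrix.mul_assoc, hc1, Matrix.mul_assoc]
    rw [Matrix.mul_sub, Matrix.mul_add, Matrix.sub_mul, Matrix.add_mul, g1, g2, hc2]
  obtain ⟨α, β, γ, h, -⟩ := aux_commuting a c hsym A B1 _ hA hB1 hC3 hc1 hAC3 hc3
  refine ⟨α, β, γ, ?_⟩
  have h' := aux_approx a c hsym hE3 (EM.poly A B1 (C2 + B1 * K3 - K3 * B1)) hs3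
    (fun t => (hA.add (hB1.smul t)).add (hC3.smul _)) h
  simp only [ht3, ht2, ht1] at h'
  exact h'

/-- The expansion determines the directional derivatives. -/
theorem aux_DD {n p : ℕ} [NeZero p]
    (a : Fin p → Fin n → ℝ) (c : Fin p → ℝ)
    (hsym : ∀ (σ : Equiv.Perm (Fin n)) (x : Fin n → ℝ), pwa a c (x ∘ σ) = pwa a c x)
    (X H W : Matrix (Fin n) (Fin n) ℝ) (hX : X.IsSymm) (hH : H.IsSymm) (hW : W.IsSymm)
    (α β γ : ℝ)
    (h : E2 (fun t => pwa a c (lamVec (X + t • H + (t ^ 2 / 2) • W))) α β γ) :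
    pwa a c (lamVec X) = α ∧ dirDeriv (fun X => pwa a c (lamVec X)) X H = β ∧
      dirDeriv2 (fun X => pwa a c (lamVec X)) X H W = 2 * γ := by
  have hFs : ∀ t : ℝ, (X + t • H + (t ^ 2 / 2) • W).IsSymm := fun t =>
    (hX.add (hH.smul t)).add (hW.smul _)
  have hα : pwa a c (lamVec X) = α := by
    have hz : Tendsto (fun t : ℝ => (∑ i, ∑ j, |a i j|) *
        ∑ j, ∑ k, |t * H j k + t ^ 2 / 2 * W j k|) (𝓝[>] (0:ℝ)) (𝓝 ((∑ i, ∑ j, |a i j|) *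
        ∑ j, ∑ k, |(0:ℝ) * H j k + 0 ^ 2 / 2 * W j k|)) := by
      refine Tendsto.mono_left (Continuous.tendsto ?_ 0) nhdsWithin_le_nhds
      fun_prop
    simp only [zero_mul, ne_eq, OfNat.ofNat_ne_zero, not_false_eq_true, zero_pow, zero_div,
      add_zero, abs_zero, Finset.sum_const_zero, mul_zero] at hz
    have h1 : Tendsto (fun t : ℝ => pwa a c (lamVec (X + t • H + (t ^ 2 / 2) • W)) -
        pwa a c (lamVec X)) (𝓝[>] (0:ℝ)) (𝓝 0) := by
      refine squeeze_zero_norm (fun t => ?_) hz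
      refine (aux_lip a c hsym _ _ (hFs t) hX).trans (le_of_eq ?_)
      congr 1
      refine Finset.sum_congr rfl fun j _ => Finset.sum_congr rfl fun k _ => ?_
      simp [add_assoc]
    have h2 := (h.tendsto0).sub_const (pwa a c (lamVec X))
    have := tendsto_nhds_unique h1 h2
    linarith
  have hβ : dirDeriv (fun X => pwa a c (lamVec X)) X H = β := by
    unfold dirDeriv
    apply Tendsto.limUnder_eq
    have hz : Tendsto (fun t : ℝ => |t| * ((∑ i, ∑ j, |a i j|) *
        ∑ j, ∑ k, |W j k|)) (𝓝[>] (0:ℝ)) (𝓝 (|0| * ((∑ i, ∑ j, |a i j|) *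
        ∑ j, ∑ k, |W j k|))) := aux_id_tendsto.abs.mul_const _
    simp only [abs_zero, zero_mul] at hz
    have h1 : Tendsto (fun t : ℝ => (pwa a c (lamVec (X + t • H)) -
        pwa a c (lamVec (X + t • H + (t ^ 2 / 2) • W))) / t) (𝓝[>] (0:ℝ)) (𝓝 0) := by
      refine squeeze_zero_norm' ?_ hz
      filter_upwards [self_mem_nhdsWithin] with t ht
      have ht' : 0 < t := ht
      rw [Real.norm_eq_abs, abs_div, div_le_iff₀ (abs_pos.mpr ht'.ne')]
      refine (aux_lip a c hsym _ _ (hX.add (hH.smul t)) (hFs t)).trans ?_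
      have hL : 0 ≤ ∑ i, ∑ j, |a i j| :=
        Finset.sum_nonneg fun _ _ => Finset.sum_nonneg fun _ _ => abs_nonneg _
      have hS : ∑ j, ∑ k, |(X + t • H) j k - (X + t • H + (t ^ 2 / 2) • W) j k| =
          t ^ 2 / 2 * ∑ j, ∑ k, |W j k| := by
        rw [Finset.mul_sum]
        refine Finset.sum_congr rfl fun j _ => ?_
        rw [Finset.mul_sum]
        refine Finset.sum_congr rfl fun k _ => ?_
        have : (X + t • H) j k - (X + t • H + (t ^ 2 / 2) • W) j k = - (t ^ 2 / 2 * W j k) := by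
          simp
        rw [this, abs_neg, abs_mul, abs_of_nonneg (by positivity : 0 ≤ t ^ 2 / 2)]
      rw [hS, abs_of_pos ht']
      have hWn : 0 ≤ ∑ j, ∑ k, |W j k| :=
        Finset.sum_nonneg fun _ _ => Finset.sum_nonneg fun _ _ => abs_nonneg _
      nlinarith [mul_nonneg (mul_nonneg hL hWn) (sq_nonneg t)]
    have h2 := h1.add h.tendsto1
    rw [zero_add] at h2
    refine h2.congr fun t => ?_
    simp only [hα]
    ring
  refine ⟨hα, hβ, ?_⟩
  unfold dirDeriv2
  apply Tendsto.limUnder_eq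
  rw [hβ]
  simp only [hα]
  have := Tendsto.const_mul 2 h
  refine this.congr' ?_
  filter_upwards [self_mem_nhdsWithin] with t ht
  have ht' : t ≠ 0 := ne_of_gt ht
  field_simp
  ring

theorem aux_mip_eq {n : ℕ} (A B : Matrix (Fin n) (Fin n) ℝ) :
    mip A B = ∑ i, ∑ j, A j i * B j i := by
  simp [mip, Matrix.trace, Matrix.mul_apply]

theorem aux_mip_diag {n : ℕ} (U M : Matrix (Fin n) (Fin n) ℝ) (hU : Uᵀ * U = 1) (y : Fin n → ℝ) :
    mip (U * diagonal y * Uᵀ) (U * M * Uᵀ) = ∑ i, y i * M i i := by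
  have e : (U * diagonal y * Uᵀ)ᵀ * (U * M * Uᵀ) = U * (diagonal y * M) * Uᵀ := by
    calc _ = U * diagonal y * (Uᵀ * U) * M * Uᵀ := by simp [Matrix.mul_assoc]
      _ = _ := by rw [hU]; simp only [Matrix.mul_assoc, Matrix.one_mul]
  rw [mip, e, Matrix.mul_assoc, Matrix.trace_mul_comm, Matrix.mul_assoc, hU, Matrix.mul_one]
  simp [Matrix.trace]

theorem aux_mip_E2 {n : ℕ} (Y : Matrix (Fin n) (Fin n) ℝ) {F : ℝ → Matrix (Fin n) (Fin n) ℝ}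
    {A B C : Matrix (Fin n) (Fin n) ℝ} (hF : EM F A B C) :
    E2 (fun t => mip Y (F t)) (mip Y A) (mip Y B) (mip Y C) := by
  simp only [aux_mip_eq]
  refine E2.sum _ fun i => E2.sum _ fun j => ?_
  have := (E2.const (Y j i)).mul (hF j i)
  simpa using this

theorem aux_Rii {n : ℕ} (x : Fin n → ℝ) (H : Matrix (Fin n) (Fin n) ℝ) (hH : H.IsSymm) (i : Fin n) :
    (H * KK x H - KK x H * H + (1/2 : ℝ) • (diagonal x * (KK x H * KK x H) +
      (KK x H * KK x H) * diagonal x) - KK x H * diagonal x * KK x H) i i =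
      - ∑ k, H i k * (x k - x i)⁻¹ * H i k := by
  have h3 : (KK x H * diagonal x * KK x H) i i = ∑ k, KK x H i k * x k * KK x H k i := by
    rw [Matrix.mul_apply]; simp only [mul_diagonal]
  simp only [Matrix.sub_apply, Matrix.add_apply, Matrix.smul_apply, diagonal_mul, mul_diagonal,
    smul_eq_mul]
  rw [h3]
  simp only [Matrix.mul_apply]
  have : x i * ∑ j, KK x H i j * KK x H j i + (∑ j, KK x H i j * KK x H j i) * x i =
      ∑ j, 2 * x i * (KK x H i j * KK x H j i) := by
    rw [← Finset.mul_sum]; ring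
  rw [this, Finset.mul_sum, ← Finset.sum_sub_distrib, ← Finset.sum_add_distrib,
    ← Finset.sum_sub_distrib, ← Finset.sum_neg_distrib]
  refine Finset.sum_congr rfl fun k _ => ?_
  simp only [KK, of_apply]
  rw [hH.apply i k]
  by_cases h : x k = x i
  · simp [h]
  · have h1 : x k - x i ≠ 0 := sub_ne_zero.mpr h
    have h2 : x i - x k ≠ 0 := sub_ne_zero.mpr (Ne.symm h)
    rw [← neg_sub (x k) (x i)]
    field_simp
    ring



/-! ### Assembly -/

theorem aux_cj {n : ℕ} (U : Matrix (Fin n) (Fin n) ℝ) (hU : Uᵀ * U = 1)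
    (P R : Matrix (Fin n) (Fin n) ℝ) : (U * P * Uᵀ) * (U * R * Uᵀ) = U * (P * R) * Uᵀ := by
  calc _ = U * P * (Uᵀ * U) * R * Uᵀ := by simp only [Matrix.mul_assoc]
    _ = _ := by rw [hU]; simp only [Matrix.mul_assoc, Matrix.one_mul]

/-- The sigma term in coordinates. -/
theorem aux_upsilon {n : ℕ} (X Y U H : Matrix (Fin n) (Fin n) ℝ) (hU : Uᵀ * U = 1)
    (hX : X = U * diagonal (lamVec X) * Uᵀ) (hH : H.IsSymm) :
    Upsilon X Y U H = 2 * ∑ i, lamVec Y i *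
      ∑ k, (Uᵀ * H * U) i k * (lamVec X k - lamVec X i)⁻¹ * (Uᵀ * H * U) i k := by
  have hU' : U * Uᵀ = 1 := mul_eq_one_comm.mp hU
  unfold Upsilon
  congr 1
  refine Finset.sum_congr rfl fun i _ => ?_
  congr 1
  have e : X - lamVec X i • (1 : Matrix (Fin n) (Fin n) ℝ) =
      U * diagonal (fun k => lamVec X k - lamVec X i) * Uᵀ := by
    have e1 : diagonal (fun k => lamVec X k - lamVec X i) =
        diagonal (lamVec X) - lamVec X i • (1 : Matrix (Fin n) (Fin n) ℝ) := by
      rw [smul_one_eq_diagonal, diagonal_sub]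
    rw [e1, Matrix.mul_sub, Matrix.sub_mul, ← hX]
    simp [hU']
  rw [e, aux_mpInv U hU]
  have e2 : ∀ D : Matrix (Fin n) (Fin n) ℝ,
      Uᵀ * H * (U * D * Uᵀ) * H * U = (Uᵀ * H * U) * D * (Uᵀ * H * U) := by
    intro D; simp only [Matrix.mul_assoc]
  rw [e2, Matrix.mul_apply]
  refine Finset.sum_congr rfl fun k _ => ?_
  rw [mul_diagonal, (aux_symm_conj hH U).apply i k]

theorem aux_main {n p : ℕ} [NeZero p]
    (a : Fin p → Fin n → ℝ) (c : Fin p → ℝ)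
    (hsym : ∀ (σ : Equiv.Perm (Fin n)) (x : Fin n → ℝ), pwa a c (x ∘ σ) = pwa a c x)
    (X : Matrix (Fin n) (Fin n) ℝ) (hXs : X.IsSymm)
    (Y : Matrix (Fin n) (Fin n) ℝ) (hY : Y ∈ msubdiff (fun X => pwa a c (lamVec X)) X)
    (U : Matrix (Fin n) (Fin n) ℝ) (hU : U ∈ OSet X ∩ OSet Y)
    (H : Matrix (Fin n) (Fin n) ℝ) (hH : H.IsSymm)
    (hcrit : dirDeriv (fun X => pwa a c (lamVec X)) X H = mip Y H) :
    IsGreatest {t : ℝ | ∃ W : Matrix (Fin n) (Fin n) ℝ, W.IsSymm ∧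
        t = mip W Y - dirDeriv2 (fun X => pwa a c (lamVec X)) X H W} (Upsilon X Y U H) := by
  obtain ⟨⟨hU1, hX⟩, ⟨-, hYd⟩⟩ := hU
  obtain ⟨hYs, hsub⟩ := hY
  have hU2 : U * Uᵀ = 1 := mul_eq_one_comm.mp hU1
  have hΥ := aux_upsilon X Y U H hU1 hX hH
  set x := lamVec X with hx
  set y := lamVec Y with hy
  obtain ⟨G, hG⟩ : ∃ G, G = Uᵀ * H * U := ⟨_, rfl⟩
  have hGs : G.IsSymm := hG ▸ aux_symm_conj hH U
  have hHG : H = U * G * Uᵀ := by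
    rw [hG]
    calc H = (U * Uᵀ) * H * (U * Uᵀ) := by simp [hU2]
      _ = _ := by simp only [Matrix.mul_assoc]
  rw [← hG] at hΥ
  obtain ⟨K, hKd⟩ : ∃ K, K = U * KK x G * Uᵀ := ⟨_, rfl⟩
  have hK : Kᵀ = -K := by
    rw [hKd, transpose_mul, transpose_mul, KK_skew x G hGs, transpose_transpose]
    simp [Matrix.mul_assoc]
  obtain ⟨B, hBd⟩ : ∃ B, B = H + X * K - K * X := ⟨_, rfl⟩
  have hB : B = U * (G + diagonal x * KK x G - KK x G * diagonal x) * Uᵀ := by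
    rw [hBd, hHG, hX, hKd, aux_cj U hU1, aux_cj U hU1]
    simp only [Matrix.mul_add, Matrix.add_mul, Matrix.mul_sub, Matrix.sub_mul]
  have hXB : X * B = B * X := by
    rw [hB, hX, aux_cj U hU1, aux_cj U hU1, KK_comm]
  obtain ⟨R, hRd⟩ : ∃ R, R = H * K - K * H + (1/2 : ℝ) • (X * (K * K) + (K * K) * X)
    - K * X * K := ⟨_, rfl⟩
  have hR : R = U * (G * KK x G - KK x G * G + (1/2 : ℝ) • (diagonal x * (KK x G * KK x G) +
      (KK x G * KK x G) * diagonal x) - KK x G * diagonal x * KK x G) * Uᵀ := by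
    rw [hRd, hHG, hX, hKd]
    simp only [aux_cj U hU1]
    simp only [Matrix.mul_add, Matrix.add_mul, Matrix.mul_sub, Matrix.sub_mul, Matrix.mul_smul,
      Matrix.smul_mul]
  have hYR : 2 * mip Y R = - Upsilon X Y U H := by
    rw [hYd, hR, aux_mip_diag U _ hU1, ← hYd, hΥ]
    simp only [aux_Rii x G hGs, mul_neg, Finset.sum_neg_distrib]
  have hYB : mip Y B = mip Y H := by
    rw [hYd, hB, hHG, aux_mip_diag U _ hU1, aux_mip_diag U _ hU1]
    refine Finset.sum_congr rfl fun i _ => ?_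
    rw [KK_block]; simp
  have hcomm : ∀ W, mip W Y = mip Y W := fun W => by
    simp only [aux_mip_eq]
    exact Finset.sum_congr rfl fun i _ => Finset.sum_congr rfl fun j _ => mul_comm _ _
  have hadd : ∀ P Q, mip Y (P + Q) = mip Y P + mip Y Q := fun P Q => by
    simp [mip, Matrix.mul_add]
  have hsubm : ∀ P Q, mip Y (P - Q) = mip Y P - mip Y Q := fun P Q => by
    simp [mip, Matrix.mul_sub]
  have hsmul : ∀ (s : ℝ) P, mip Y (s • P) = s * mip Y P := fun s P => by
    simp [mip]
  have hFE : ∀ W : Matrix (Fin n) (Fin n) ℝ,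
      EM (fun t => X + t • H + (t ^ 2 / 2) • W) X H ((1/2 : ℝ) • W) := fun W => by
    have := EM.poly X H ((1/2 : ℝ) • W)
    convert this using 3 with t
    rw [smul_smul]; congr 1; ring
  have hFs : ∀ W : Matrix (Fin n) (Fin n) ℝ, W.IsSymm → ∀ t : ℝ,
      (X + t • H + (t ^ 2 / 2) • W).IsSymm := fun W hW t =>
    (hXs.add (hH.smul t)).add (hW.smul _)
  have hconj : ∀ W : Matrix (Fin n) (Fin n) ℝ, W.IsSymm →
      ∃ Q : ℝ → Matrix (Fin n) (Fin n) ℝ,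
      (∀ t, ((Q t)ᵀ * (X + t • H + (t ^ 2 / 2) • W) * Q t).IsSymm) ∧
      (∀ t, pwa a c (lamVec ((Q t)ᵀ * (X + t • H + (t ^ 2 / 2) • W) * Q t)) =
        pwa a c (lamVec (X + t • H + (t ^ 2 / 2) • W))) ∧
      EM (fun t => (Q t)ᵀ * (X + t • H + (t ^ 2 / 2) • W) * Q t) X B ((1/2 : ℝ) • W + R) := by
    intro W hW
    obtain ⟨Q, hQ, hE⟩ := aux_conjstep _ X H _ K (hFE W) hK
    rw [← hBd, ← hRd] at hE
    exact ⟨Q, fun t => aux_symm_conj (hFs W hW t) _,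
      fun t => aux_inv a c hsym _ (hFs W hW t) _ (hQ t), hE⟩
  have hRsB : R.IsSymm ∧ B.IsSymm := by
    obtain ⟨Q, hs, -, hE⟩ := hconj 0 (by simp [Matrix.IsSymm])
    have := hE.symm_coeffs hs
    simp only [smul_zero, zero_add] at this
    exact ⟨this.2.2, this.2.1⟩
  obtain ⟨hRs, hBs⟩ := hRsB
  constructor
  · have hW : ((-2 : ℝ) • R).IsSymm := hRs.smul _
    refine ⟨(-2 : ℝ) • R, hW, ?_⟩
    obtain ⟨Q, hs, hinv, hE⟩ := hconj _ hW
    have e0 : (1/2 : ℝ) • ((-2 : ℝ) • R) + R = 0 := by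
      rw [smul_smul]; norm_num
    rw [e0] at hE
    obtain ⟨α, β, γ, h, hγ⟩ := aux_commuting a c hsym X B 0 hXs hBs (by simp [Matrix.IsSymm])
      hXB (by simp) (by simp)
    have h' := aux_approx a c hsym hE (EM.poly X B 0) hs
      (fun t => (hXs.add (hBs.smul t)).add (by simp [Matrix.IsSymm])) h
    simp only [hinv] at h'
    obtain ⟨-, -, h3⟩ := aux_DD a c hsym X H _ hXs hH hW α β γ h'
    rw [h3, hγ rfl, hcomm, hsmul]
    linarith
  · rintro _ ⟨W, hW, rfl⟩
    obtain ⟨α, β, γ, h⟩ := aux_exists a c hsym _ X H _ (hFE W) (hFs W hW)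
    obtain ⟨h1, h2, h3⟩ := aux_DD a c hsym X H W hXs hH hW α β γ h
    obtain ⟨Q, hs, hinv, hE⟩ := hconj W hW
    rw [hcrit] at h2
    have hm := aux_mip_E2 Y hE
    have hle : mip Y ((1/2 : ℝ) • W + R) ≤ γ := by
      refine le_of_tendsto_of_tendsto' hm h fun t => ?_
      refine div_le_div_of_nonneg_right ?_ (sq_nonneg t)
      have := hsub _ (hs t)
      simp only [hinv, hsubm, h1] at this
      rw [hYB, h2]
      linarith
    rw [hadd, hsmul] at hle
    rw [h3, hcomm]
    linarith


/-- Proposition 3.4.  For `H` in the critical cone `C(X̄+Ȳ; ∂θ₁(X̄))`, the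
conjugate of the second-order directional derivative `W ↦ θ₁''(X̄;H,W)` evaluated at `Ȳ`
equals `2 ∑_l ⟨Λ(Ȳ)_{αˡαˡ}, Ūᵀ_{αˡ} H (X̄ - v̄ₗ I)† H Ū_{αˡ}⟩`. -/
theorem stmt7 {n p : ℕ} [NeZero p]
    (a : Fin p → Fin n → ℝ) (c : Fin p → ℝ)
    (hsym : ∀ (σ : Equiv.Perm (Fin n)) (x : Fin n → ℝ), pwa a c (x ∘ σ) = pwa a c x)
    (theta1 : Matrix (Fin n) (Fin n) ℝ → ℝ)
    (htheta1 : theta1 = fun X => pwa a c (lamVec X))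
    (Xb : Matrix (Fin n) (Fin n) ℝ) (hXb : Xb.IsSymm)
    (Yb : Matrix (Fin n) (Fin n) ℝ) (hYb : Yb ∈ msubdiff theta1 Xb)
    (Ub : Matrix (Fin n) (Fin n) ℝ) (hUb : Ub ∈ OSet Xb ∩ OSet Yb)
    (H : Matrix (Fin n) (Fin n) ℝ) (hH : H.IsSymm)
    (hcrit : dirDeriv theta1 Xb H = mip Yb H) :
    sSup {t : ℝ | ∃ W : Matrix (Fin n) (Fin n) ℝ, W.IsSymm ∧
        t = mip W Yb - dirDeriv2 theta1 Xb H W} =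
      Upsilon Xb Yb Ub H := by
  subst htheta1
  exact (aux_main a c hsym Xb hXb Yb hYb Ub hUb H hH hcrit).csSup_eq

end
end

section
/- Let ζ = ψ∘λ with ψ symmetric convex piecewise affine, K = {X ∈ Sⁿ : ζ(X) ≤ 0}, and X̄ ∈ K with ζ(X̄) = 0. Then H ∈ lin(T_K(X̄)) (the lineality space {H : ζ'(X̄;H) = −ζ'(X̄;−H) = 0}) if and only if ⟨λ'(X̄;H), bⁱ⟩ = 0 for all i ∈ ι2(λ(X̄)). Moreover, if H ∈ lin(T_K(X̄)), then there exist scalars ρ̃_l, for each l in F̃ := {l : there exist i,j ∈ α^l with (a^w)_i ≠ (a^w)_j for some w ∈ ι2(λ(X̄))}, such that V̄ᵀ_{α^l} H V̄_{α^l} = ρ̃_l I_{|α^l|} for every V̄ ∈ 𝕆ⁿ(X̄). -/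
open Matrix Filter Topology Set
open scoped Classical

noncomputable section

/-- The active index set `ι₂(x̄) = {i : ⟨bⁱ,x̄⟩ = dᵢ}`. -/
def iotaC {n q : ℕ} (b : Fin q → Fin n → ℝ) (d : Fin q → ℝ) (x : Fin n → ℝ) : Set (Fin q) :=
  {i | b i ⬝ᵥ x = d i}

/-- The index set `η₂(x̄,z̄)`: active indices carrying a strictly positive weight in some
conic-combination representation of `z̄` by the active `bⁱ`'s. -/
def etaC {n q : ℕ} (b : Fin q → Fin n → ℝ) (d : Fin q → ℝ)
    (x z : Fin n → ℝ) : Set (Fin q) :=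
  {i | ∃ u : Fin q → ℝ, (∀ j, 0 ≤ u j) ∧ (∀ j, j ∉ iotaC b d x → u j = 0) ∧
        z = ∑ j, u j • b j ∧ 0 < u i}

/-- The normal cone (within `Sⁿ`) of a set of symmetric matrices. -/
def NK {n : ℕ} (K : Set (Matrix (Fin n) (Fin n) ℝ)) (X : Matrix (Fin n) (Fin n) ℝ) :
    Set (Matrix (Fin n) (Fin n) ℝ) :=
  {Z | Z.IsSymm ∧ ∀ Y ∈ K, mip Z (Y - X) ≤ 0}

/-- `i` and `j` belong to the same block `αˡ` of `X̄`. -/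
def sameA {n : ℕ} (X : Matrix (Fin n) (Fin n) ℝ) (i j : Fin n) : Prop :=
  lamVec X i = lamVec X j

/-- `i` and `j` belong to the same sub-block `γˡₖ` (determined by the eigenvalues of both `X̄`
and `Z̄`). -/
def sameG {n : ℕ} (X Z : Matrix (Fin n) (Fin n) ℝ) (i j : Fin n) : Prop :=
  lamVec X i = lamVec X j ∧ lamVec Z i = lamVec Z j

/-- The sub-block `γˡₖ` containing `i` is a "bad" block, i.e. `k ∈ Fₗ`: some `b^w`,
`w ∈ η₂(λ(X̄),λ(Z̄))`, is non-constant on it. -/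
def badG {n q : ℕ} (b : Fin q → Fin n → ℝ) (d : Fin q → ℝ)
    (X Z : Matrix (Fin n) (Fin n) ℝ) (i : Fin n) : Prop :=
  ∃ z z' : Fin n, sameG X Z z i ∧ sameG X Z z' i ∧
    ∃ w ∈ etaC b d (lamVec X) (lamVec Z), b w z ≠ b w z'


theorem aux_lamVec_antitone {n : ℕ} (X : Matrix (Fin n) (Fin n) ℝ) : Antitone (lamVec X) := by
  unfold lamVec
  split_ifs with h
  · intro i j hij
    exact Tuple.monotone_sort h.eigenvalues (Fin.rev_le_rev.mpr hij)
  · intro i j _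
    exact le_rfl

theorem aux_OSet_nonempty {n : ℕ} (X : Matrix (Fin n) (Fin n) ℝ) (hX : X.IsSymm) :
    (OSet X).Nonempty := by
  have h : X.IsHermitian := by
    rw [Matrix.IsHermitian, Matrix.conjTranspose_eq_transpose_of_trivial]; exact hX
  set W : Matrix (Fin n) (Fin n) ℝ := (h.eigenvectorUnitary).1 with hW
  have hWW : Wᵀ * W = 1 := by
    have := Unitary.coe_star_mul_self h.eigenvectorUnitary
    rwa [Matrix.star_eq_conjTranspose, Matrix.conjTranspose_eq_transpose_of_trivial] at this
  have hsp : X = W * diagonal h.eigenvalues * Wᵀ := by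
    have := h.spectral_theorem
    rw [Unitary.conjStarAlgAut_apply, Matrix.star_eq_conjTranspose,
      Matrix.conjTranspose_eq_transpose_of_trivial] at this
    exact this
  let e : Equiv.Perm (Fin n) := Fin.revPerm.trans (Tuple.sort h.eigenvalues)
  have hl : lamVec X = h.eigenvalues ∘ e := by
    unfold lamVec
    rw [dif_pos h]
    rfl
  refine ⟨W.submatrix id e, ?_, ?_⟩
  · rw [Matrix.transpose_submatrix, ← Matrix.submatrix_mul Wᵀ W e id e Function.bijective_id, hWW]
    simp
  · rw [hl]
    have : diagonal (h.eigenvalues ∘ e) = (diagonal h.eigenvalues).submatrix e e := by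
      rw [Matrix.submatrix_diagonal_equiv]
    rw [this, Matrix.transpose_submatrix, Matrix.submatrix_mul_equiv,
      Matrix.submatrix_mul_equiv, ← hsp]
    simp

theorem aux_quad {n : ℕ} {X U : Matrix (Fin n) (Fin n) ℝ} (hU : U ∈ OSet X) (u : Fin n → ℝ) :
    u ⬝ᵥ (X *ᵥ u) = ∑ i, lamVec X i * ((Uᵀ *ᵥ u) i)^2 := by
  have h1 := hU.2
  calc u ⬝ᵥ (X *ᵥ u) = u ⬝ᵥ ((U * diagonal (lamVec X) * Uᵀ) *ᵥ u) := by rw [← h1]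
    _ = (Uᵀ *ᵥ u) ⬝ᵥ (diagonal (lamVec X) *ᵥ (Uᵀ *ᵥ u)) := by
      rw [← Matrix.mulVec_mulVec, ← Matrix.mulVec_mulVec, Matrix.dotProduct_mulVec,
        ← Matrix.mulVec_transpose]
    _ = _ := by
      simp only [dotProduct, Matrix.mulVec_diagonal]
      exact Finset.sum_congr rfl fun i _ => by ring

theorem aux_norm {n : ℕ} {X U : Matrix (Fin n) (Fin n) ℝ} (hU : U ∈ OSet X) (u : Fin n → ℝ) :
    u ⬝ᵥ u = ∑ i, ((Uᵀ *ᵥ u) i)^2 := by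
  have h1 : U * Uᵀ = 1 := mul_eq_one_comm.mp hU.1
  calc u ⬝ᵥ u = u ⬝ᵥ ((U * Uᵀ) *ᵥ u) := by rw [h1, one_mulVec]
    _ = (Uᵀ *ᵥ u) ⬝ᵥ (Uᵀ *ᵥ u) := by
      rw [← Matrix.mulVec_mulVec, Matrix.dotProduct_mulVec, ← Matrix.mulVec_transpose]
    _ = _ := by
      simp only [dotProduct]
      exact Finset.sum_congr rfl fun i _ => by ring

theorem aux_bound {n : ℕ} (E : Matrix (Fin n) (Fin n) ℝ) (u : Fin n → ℝ) :
    u ⬝ᵥ (E *ᵥ u) ≤ (∑ i, ∑ j, |E i j|) * (u ⬝ᵥ u) := by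
  have hle : ∀ i, u i ^ 2 ≤ u ⬝ᵥ u := by
    intro i
    have := Finset.single_le_sum (f := fun i => u i * u i) (fun j _ => mul_self_nonneg (u j))
      (Finset.mem_univ i)
    simp only [dotProduct]
    linarith [this, sq (u i)]
  simp only [dotProduct] at *
  simp only [mulVec, dotProduct]
  rw [Finset.sum_mul]
  refine Finset.sum_le_sum fun i _ => ?_
  rw [Finset.sum_mul, Finset.mul_sum]
  refine Finset.sum_le_sum fun j _ => ?_
  have h1 := hle i
  have h2 := hle j
  have h3 : |u i * u j| ≤ ∑ i, u i * u i := by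
    rw [abs_le]; constructor <;> nlinarith [sq_nonneg (u i - u j), sq_nonneg (u i + u j)]
  calc u i * (E i j * u j) = E i j * (u i * u j) := by ring
    _ ≤ |E i j * (u i * u j)| := le_abs_self _
    _ = |E i j| * |u i * u j| := abs_mul _ _
    _ ≤ _ := mul_le_mul_of_nonneg_left h3 (abs_nonneg _)

/-- Weyl inequality for the ordered eigenvalues. -/
theorem aux_weyl {n : ℕ} (X E : Matrix (Fin n) (Fin n) ℝ) (hX : X.IsSymm) (hE : E.IsSymm)
    (k : Fin n) : lamVec (X + E) k ≤ lamVec X k + ∑ i, ∑ j, |E i j| := by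
  obtain ⟨U, hU⟩ := aux_OSet_nonempty (X + E) (hX.add hE)
  obtain ⟨V, hV⟩ := aux_OSet_nonempty X hX
  let f : (Fin n → ℝ) →ₗ[ℝ] ({i : Fin n // i ≠ k} → ℝ) :=
    LinearMap.pi fun i => if k < i.1 then (LinearMap.proj i.1) ∘ₗ Uᵀ.mulVecLin
      else (LinearMap.proj i.1) ∘ₗ Vᵀ.mulVecLin
  have hker : LinearMap.ker f ≠ ⊥ := by
    apply LinearMap.ker_ne_bot_of_finrank_lt
    rw [Module.finrank_fintype_fun_eq_card, Module.finrank_fintype_fun_eq_card]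
    exact Fintype.card_subtype_lt (p := fun i => i ≠ k) (x := k) (by simp)
  obtain ⟨u, hu, hu0⟩ := (Submodule.ne_bot_iff _).mp hker
  have hu1 : ∀ i, k < i → (Uᵀ *ᵥ u) i = 0 := by
    intro i hi
    have := congrFun (LinearMap.mem_ker.mp hu) ⟨i, hi.ne'⟩
    rw [LinearMap.pi_apply, if_pos hi] at this
    exact this
  have hu2 : ∀ i, i < k → (Vᵀ *ᵥ u) i = 0 := by
    intro i hi
    have := congrFun (LinearMap.mem_ker.mp hu) ⟨i, hi.ne⟩
    rw [LinearMap.pi_apply, if_neg hi.not_gt] at this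
    exact this
  have hpos : 0 < u ⬝ᵥ u := by
    have : 0 ≤ u ⬝ᵥ u := Finset.sum_nonneg fun i _ => mul_self_nonneg _
    exact lt_of_le_of_ne this (fun h => hu0 (dotProduct_self_eq_zero.mp h.symm))
  have h1 : lamVec (X + E) k * (u ⬝ᵥ u) ≤ u ⬝ᵥ ((X + E) *ᵥ u) := by
    rw [aux_quad hU, aux_norm hU, Finset.mul_sum]
    refine Finset.sum_le_sum fun i _ => ?_
    rcases lt_or_ge k i with h | h
    · rw [hu1 i h]; simp
    · exact mul_le_mul_of_nonneg_right (aux_lamVec_antitone _ h) (sq_nonneg _)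
  have h2 : u ⬝ᵥ (X *ᵥ u) ≤ lamVec X k * (u ⬝ᵥ u) := by
    rw [aux_quad hV, aux_norm hV, Finset.mul_sum]
    refine Finset.sum_le_sum fun i _ => ?_
    rcases lt_or_ge i k with h | h
    · rw [hu2 i h]; simp
    · exact mul_le_mul_of_nonneg_right (aux_lamVec_antitone _ h) (sq_nonneg _)
  have h3 := aux_bound E u
  rw [Matrix.add_mulVec, dotProduct_add] at h1
  by_contra hcon
  push Not at hcon
  nlinarith [mul_lt_mul_of_pos_right hcon hpos]

theorem aux_weyl_abs {n : ℕ} (X H : Matrix (Fin n) (Fin n) ℝ) (hX : X.IsSymm) (hH : H.IsSymm)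
    (k : Fin n) (t : ℝ) :
    |lamVec (X + t • H) k - lamVec X k| ≤ |t| * ∑ i, ∑ j, |H i j| := by
  have e1 : ∑ i, ∑ j, |(t • H) i j| = |t| * ∑ i, ∑ j, |H i j| := by
    simp [Finset.mul_sum, abs_mul]
  have e2 : ∑ i, ∑ j, |(-(t • H)) i j| = |t| * ∑ i, ∑ j, |H i j| := by
    simp [Finset.mul_sum, abs_mul]
  have h1 := aux_weyl X (t • H) hX (hH.smul t) k
  have h2 := aux_weyl (X + t • H) (-(t • H)) (hX.add (hH.smul t)) (hH.smul t).neg k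
  rw [e1] at h1
  rw [e2, add_neg_cancel_right] at h2
  rw [abs_le]; constructor <;> linarith

theorem aux_det {n : ℕ} {X U : Matrix (Fin n) (Fin n) ℝ} (hU : U ∈ OSet X) (c : ℝ) :
    (c • (1 : Matrix (Fin n) (Fin n) ℝ) - X).det = ∏ i, (c - lamVec X i) := by
  have h1 : U * Uᵀ = 1 := mul_eq_one_comm.mp hU.1
  have h2 : c • (1 : Matrix (Fin n) (Fin n) ℝ) - X
      = U * diagonal (fun i => c - lamVec X i) * Uᵀ := by
    have h3 : diagonal (fun i => c - lamVec X i)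
        = c • (1 : Matrix (Fin n) (Fin n) ℝ) - diagonal (lamVec X) := by
      ext i j
      by_cases hij : i = j
      · subst hij; simp
      · simp [hij]
    rw [h3, Matrix.mul_sub, Matrix.sub_mul, ← hU.2]
    simp [h1]
  have h4 : U.det * Uᵀ.det = 1 := by rw [← det_mul, h1, det_one]
  rw [h2, det_mul, det_mul, det_diagonal]
  calc _ = (U.det * Uᵀ.det) * ∏ i, (c - lamVec X i) := by ring
    _ = _ := by rw [h4, one_mul]

/-- Limits of eigenvalue difference quotients are, on each block, the roots of the characteristic
polynomial of the corresponding compressed direction. -/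
theorem aux_key {n : ℕ} {X H V : Matrix (Fin n) (Fin n) ℝ} (hX : X.IsSymm) (hH : H.IsSymm)
    (hV : V ∈ OSet X) (v s : ℝ) {F : Filter ℝ} [F.NeBot] (hF : F ≤ 𝓝[>] 0) (μ : Fin n → ℝ)
    (hμ : ∀ i, Tendsto (fun t => (lamVec (X + t • H) i - lamVec X i) / t) F (𝓝 (μ i))) :
    ∏ i with lamVec X i = v, (s - μ i) =
      (s • (1 : Matrix {i // lamVec X i = v} {i // lamVec X i = v} ℝ)
        - (Vᵀ * H * V).toSquareBlockProp (fun i => lamVec X i = v)).det := by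
  set G := Vᵀ * H * V with hG
  set l := lamVec X with hl
  have hVV : V * Vᵀ = 1 := mul_eq_one_comm.mp hV.1
  have ht0 : Tendsto (fun t : ℝ => t) F (𝓝 0) := hF.trans nhdsWithin_le_nhds
  have htpos : ∀ᶠ t in F, (0:ℝ) < t := hF self_mem_nhdsWithin
  let R : Matrix (Fin n) (Fin n) ℝ := s • 1 - G
  let N : ℝ → Matrix (Fin n) (Fin n) ℝ := fun t => Matrix.of fun i j =>
    if l i = v then R i j else (if i = j then v - l i else 0) + t * R i j
  let D : ℝ → Fin n → ℝ := fun t i => if l i = v then t else 1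
  have hM : ∀ t, diagonal (D t) * N t
      = (v + t * s) • (1 : Matrix (Fin n) (Fin n) ℝ) - (diagonal l + t • G) := by
    intro t
    ext i j
    rw [Matrix.diagonal_mul]
    by_cases hi : l i = v <;> by_cases hij : i = j
    · subst hij
      simp [D, N, R, hi]; ring
    · simp [D, N, R, hi, hij]
    · subst hij
      simp [D, N, R, hi]; ring
    · simp [D, N, R, hi, hij]
  have hdet : ∀ t, (∏ i, D t i) * (N t).det = ∏ i, (v + t * s - lamVec (X + t • H) i) := by
    intro t
    obtain ⟨U, hU⟩ := aux_OSet_nonempty (X + t • H) (hX.add (hH.smul t))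
    rw [← aux_det hU, ← det_diagonal, ← det_mul, hM]
    have h3 : (v + t * s) • (1 : Matrix (Fin n) (Fin n) ℝ) - (X + t • H)
        = V * ((v + t * s) • (1 : Matrix (Fin n) (Fin n) ℝ) - (diagonal l + t • G)) * Vᵀ := by
      have e1 : V * G * Vᵀ = H := by
        rw [hG]
        calc _ = (V * Vᵀ) * H * (V * Vᵀ) := by simp only [Matrix.mul_assoc]
          _ = H := by rw [hVV]; simp
      rw [Matrix.mul_sub, Matrix.sub_mul, Matrix.mul_add, Matrix.add_mul, ← hV.2]
      simp [hVV, e1]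
    have h4 : V.det * Vᵀ.det = 1 := by rw [← det_mul, hVV, det_one]
    rw [h3, det_mul, det_mul]
    set dd := ((v + t * s) • (1 : Matrix (Fin n) (Fin n) ℝ) - (diagonal l + t • G)).det
    calc dd = (V.det * Vᵀ.det) * dd := by rw [h4, one_mul]
      _ = _ := by ring
  have hlam : ∀ i, Tendsto (fun t => lamVec (X + t • H) i) F (𝓝 (l i)) := by
    intro i
    have h1 : Tendsto (fun t => l i + t * ((lamVec (X + t • H) i - l i) / t)) F
        (𝓝 (l i + 0 * μ i)) := tendsto_const_nhds.add (ht0.mul (hμ i))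
    rw [zero_mul, add_zero] at h1
    refine h1.congr' ?_
    filter_upwards [htpos] with t ht
    field_simp
    ring
  have hlim1 : Tendsto (fun t => (N t).det) F
      (𝓝 (∏ i, if l i = v then s - μ i else v - l i)) := by
    have h1 : Tendsto (fun t => ∏ i, (v + t * s - lamVec (X + t • H) i) / D t i) F
        (𝓝 (∏ i, if l i = v then s - μ i else v - l i)) := by
      refine tendsto_finsetProd _ fun i _ => ?_
      by_cases hi : l i = v
      · simp only [D, hi, if_true]
        refine ((tendsto_const_nhds (x := s)).sub (hμ i)).congr' ?_
        filter_upwards [htpos] with t ht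
        rw [hi]
        field_simp
        ring
      · simp only [D, hi, if_false, div_one]
        have := ((tendsto_const_nhds (x := v)).add (ht0.mul_const s)).sub (hlam i)
        simpa using this
    refine h1.congr' ?_
    filter_upwards [htpos] with t ht
    have hne : ∏ i, D t i ≠ 0 := by
      refine Finset.prod_ne_zero_iff.mpr fun i _ => ?_
      simp only [D]
      split_ifs
      · exact ht.ne'
      · exact one_ne_zero
    rw [Finset.prod_div_distrib, ← hdet, mul_div_cancel_left₀ _ hne]
  have hlim2 : Tendsto (fun t => (N t).det) F (𝓝 (N 0).det) := by
    have hc : Continuous fun t => (N t).det := by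
      refine Continuous.matrix_det ?_
      refine continuous_matrix fun i j => ?_
      simp only [N, Matrix.of_apply]
      split_ifs <;> fun_prop
    exact (hc.tendsto 0).comp ht0
  have heq := tendsto_nhds_unique hlim1 hlim2
  have hN0 : (N 0).det = (s • (1 : Matrix {i // l i = v} {i // l i = v} ℝ)
        - G.toSquareBlockProp (fun i => l i = v)).det * ∏ i with ¬ l i = v, (v - l i) := by
    rw [Matrix.twoBlockTriangular_det (N 0) (fun i => l i = v)]
    · congr 1
      · congr 1
        ext i j
        by_cases hij : i = j
        · subst hij
          simp [N, R, toSquareBlockProp_def, i.2]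
        · have : (i : Fin n) ≠ j := fun h => hij (Subtype.ext h)
          simp [N, R, toSquareBlockProp_def, i.2, hij, this]
      · have : toSquareBlockProp (N 0) (fun i => ¬ l i = v)
            = diagonal (fun i : {i // ¬ l i = v} => v - l i) := by
          ext i j
          by_cases hij : i = j
          · subst hij
            simp [N, toSquareBlockProp_def, i.2]
          · have : (i : Fin n) ≠ j := fun h => hij (Subtype.ext h)
            simp [N, toSquareBlockProp_def, i.2, hij, this]
        rw [this, det_diagonal]
        exact (Finset.prod_subtype _ (by simp) (fun i => v - l i)).symm
    · intro i hi j hj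
      have : i ≠ j := fun h => hi (h ▸ hj)
      simp [N, hi, this]
  rw [hN0, Finset.prod_ite] at heq
  refine mul_right_cancel₀ (Finset.prod_ne_zero_iff.mpr fun i hi => ?_) heq
  rw [Finset.mem_filter] at hi
  exact fun h => hi.2 (sub_eq_zero.mp h).symm

theorem aux_multiset {ι : Type*} (A : Finset ι) (μ μ' : ι → ℝ)
    (h : ∀ s : ℝ, ∏ i ∈ A, (s - μ i) = ∏ i ∈ A, (s - μ' i)) :
    A.val.map μ = A.val.map μ' := by
  have hp : ((A.val.map μ).map fun a => Polynomial.X - Polynomial.C a).prod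
      = ((A.val.map μ').map fun a => Polynomial.X - Polynomial.C a).prod := by
    apply Polynomial.funext
    intro s
    have := h s
    simp only [Multiset.map_map, Function.comp_def]
    change Polynomial.eval s (∏ i ∈ A, (Polynomial.X - Polynomial.C (μ i)))
      = Polynomial.eval s (∏ i ∈ A, (Polynomial.X - Polynomial.C (μ' i)))
    simpa [Polynomial.eval_prod] using this
  have := congrArg Polynomial.roots hp
  rwa [Polynomial.roots_multiset_prod_X_sub_C, Polynomial.roots_multiset_prod_X_sub_C] at this

theorem aux_perm {n : ℕ} (l μ μ' : Fin n → ℝ)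
    (h : ∀ v s : ℝ, ∏ i with l i = v, (s - μ i) = ∏ i with l i = v, (s - μ' i)) :
    ∃ σ : Equiv.Perm (Fin n), l ∘ σ = l ∧ μ' = μ ∘ σ := by
  let f : Fin n → ℝ × ℝ := fun i => (l i, μ i)
  let f' : Fin n → ℝ × ℝ := fun i => (l i, μ' i)
  have hc : ∀ p : ℝ × ℝ, Nonempty ({i // f' i = p} ≃ {i // f i = p}) := by
    rintro ⟨v, c⟩
    have h1 := congrArg (Multiset.count c) (aux_multiset _ _ _ (h v))
    rw [Multiset.count_map, Multiset.count_map] at h1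
    refine ⟨Fintype.equivOfCardEq ?_⟩
    rw [Fintype.card_subtype, Fintype.card_subtype]
    have e : ∀ g : Fin n → ℝ, (Multiset.filter (fun a => c = g a)
        (Finset.univ.filter fun i => l i = v).val).card
        = (Finset.univ.filter fun i => (l i, g i) = (v, c)).card := by
      intro g
      change (Finset.filter (fun a => c = g a) (Finset.univ.filter fun i => l i = v)).card = _
      rw [Finset.filter_filter]
      congr 1
      ext i
      simp [eq_comm]
    rw [e, e] at h1
    exact h1.symm
  let σ : Equiv.Perm (Fin n) := (Equiv.sigmaFiberEquiv f').symm.trans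
    ((Equiv.sigmaCongrRight fun p => (hc p).some).trans (Equiv.sigmaFiberEquiv f))
  have hσ : ∀ i, f (σ i) = f' i := fun i => ((hc (f' i)).some ⟨i, rfl⟩).2
  refine ⟨σ, ?_, ?_⟩
  · funext i; exact congrArg Prod.fst (hσ i)
  · funext i; exact (congrArg Prod.snd (hσ i)).symm

theorem aux_le_of_perm {n : ℕ} (l μ μ' : Fin n → ℝ) (σ : Equiv.Perm (Fin n))
    (hl : l ∘ σ = l) (hm : μ' = μ ∘ σ)
    (h1 : ∀ i j, i ≤ j → l i = l j → μ j ≤ μ i) (h2 : ∀ i j, i ≤ j → l i = l j → μ' j ≤ μ' i)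
    (i : Fin n) : μ' i ≤ μ i := by
  by_contra hcon
  push Not at hcon
  have hA : (Finset.univ.filter fun j => l j = l i ∧ μ' i ≤ μ' j).card
      ≤ (Finset.univ.filter fun j => l j = l i ∧ μ' i ≤ μ j).card := by
    refine Finset.card_le_card_of_injOn σ ?_ σ.injective.injOn
    intro j hj
    have hj := (Finset.mem_filter.mp hj).2
    refine Finset.mem_coe.mpr (Finset.mem_filter.mpr ⟨Finset.mem_univ _, ?_, ?_⟩)
    · rw [← hj.1]; exact congrFun hl j
    · have := congrFun hm j
      rw [Function.comp_apply] at this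
      rw [← this]; exact hj.2
  have hB : (Finset.univ.filter fun j => l j = l i ∧ j ≤ i).card
      ≤ (Finset.univ.filter fun j => l j = l i ∧ μ' i ≤ μ' j).card := by
    refine Finset.card_le_card fun j hj => ?_
    simp only [Finset.mem_filter, Finset.mem_univ, true_and] at hj ⊢
    exact ⟨hj.1, h2 j i hj.2 hj.1⟩
  have hC : (Finset.univ.filter fun j => l j = l i ∧ μ' i ≤ μ j).card
      < (Finset.univ.filter fun j => l j = l i ∧ j ≤ i).card := by
    refine Finset.card_lt_card (Finset.ssubset_iff_of_subset ?_ |>.mpr ⟨i, ?_, ?_⟩)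
    · intro j hj
      simp only [Finset.mem_filter, Finset.mem_univ, true_and] at hj ⊢
      refine ⟨hj.1, ?_⟩
      by_contra hji
      push Not at hji
      linarith [h1 i j hji.le hj.1.symm]
    · simp
    · simpa using hcon
  omega

/-- Directional differentiability of the ordered eigenvalues. -/
theorem aux_exists_s9 {n : ℕ} (X H : Matrix (Fin n) (Fin n) ℝ) (hX : X.IsSymm) (hH : H.IsSymm) :
    ∃ μ : Fin n → ℝ, ∀ i,
      Tendsto (fun t => (lamVec (X + t • H) i - lamVec X i) / t) (𝓝[>] 0) (𝓝 (μ i)) := by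
  obtain ⟨V, hV⟩ := aux_OSet_nonempty X hX
  set C := ∑ i, ∑ j, |H i j| with hC
  let m : ℝ → Fin n → ℝ := fun t i => (lamVec (X + t • H) i - lamVec X i) / t
  have hpos : ∀ᶠ t in 𝓝[>] (0:ℝ), (0:ℝ) < t := self_mem_nhdsWithin
  have hcomp : IsCompact (Set.Icc (fun _ : Fin n => -C) (fun _ => C)) := isCompact_Icc
  have hmem : ∀ᶠ t in 𝓝[>] (0:ℝ), m t ∈ Set.Icc (fun _ : Fin n => -C) (fun _ => C) := by
    filter_upwards [hpos] with t ht
    have hb : ∀ i, |m t i| ≤ C := by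
      intro i
      simp only [m]
      rw [abs_div, div_le_iff₀ (abs_pos.mpr ht.ne'), mul_comm]
      exact aux_weyl_abs X H hX hH i t
    exact ⟨fun i => (abs_le.mp (hb i)).1, fun i => (abs_le.mp (hb i)).2⟩
  have hanti : ∀ (U : Ultrafilter ℝ) (μ : Fin n → ℝ), (U : Filter ℝ) ≤ 𝓝[>] 0 →
      Tendsto m U (𝓝 μ) → ∀ i j, i ≤ j → lamVec X i = lamVec X j → μ j ≤ μ i := by
    intro U μ hU hm i j hij hl
    refine le_of_tendsto_of_tendsto ((tendsto_pi_nhds.mp hm) j) ((tendsto_pi_nhds.mp hm) i) ?_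
    filter_upwards [hU hpos] with t ht
    simp only [m]
    rw [hl]
    have := aux_lamVec_antitone (X + t • H) hij
    have ht' : (0:ℝ) < t := ht
    gcongr
  obtain ⟨μ, -, hμ⟩ := hcomp.ultrafilter_le_nhds ((Ultrafilter.of (𝓝[>] (0:ℝ))).map m)
    (by
      rw [le_principal_iff]
      exact Ultrafilter.of_le (𝓝[>] (0:ℝ)) hmem)
  have hμ : Tendsto m (Ultrafilter.of (𝓝[>] (0:ℝ))) (𝓝 μ) := hμ
  have hU0 := Ultrafilter.of_le (𝓝[>] (0:ℝ))
  suffices hT : Tendsto m (𝓝[>] 0) (𝓝 μ) from ⟨μ, tendsto_pi_nhds.mp hT⟩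
  refine hcomp.tendsto_nhds_of_unique_mapClusterPt hmem ?_
  intro μ' _ hcl
  obtain ⟨U, hU, hμ'⟩ := mapClusterPt_iff_ultrafilter.mp hcl
  have hprod : ∀ v s : ℝ, ∏ i with lamVec X i = v, (s - μ i)
      = ∏ i with lamVec X i = v, (s - μ' i) := by
    intro v s
    rw [aux_key hX hH hV v s hU0 μ (tendsto_pi_nhds.mp hμ),
      aux_key hX hH hV v s hU μ' (tendsto_pi_nhds.mp hμ')]
  obtain ⟨σ, hs1, hs2⟩ := aux_perm _ _ _ hprod
  obtain ⟨τ, ht1, ht2⟩ := aux_perm _ _ _ fun v s => (hprod v s).symm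
  funext i
  exact le_antisymm
    (aux_le_of_perm _ _ _ σ hs1 hs2 (hanti _ _ hU0 hμ) (hanti _ _ hU hμ') i)
    (aux_le_of_perm _ _ _ τ ht1 ht2 (hanti _ _ hU hμ') (hanti _ _ hU0 hμ) i)

theorem aux_neg {n : ℕ} {X H : Matrix (Fin n) (Fin n) ℝ} (hX : X.IsSymm) (hH : H.IsSymm)
    (μ μ' : Fin n → ℝ)
    (hμ : ∀ i, Tendsto (fun t => (lamVec (X + t • H) i - lamVec X i) / t) (𝓝[>] 0) (𝓝 (μ i)))
    (hμ' : ∀ i, Tendsto (fun t => (lamVec (X + t • (-H)) i - lamVec X i) / t) (𝓝[>] 0)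
      (𝓝 (μ' i))) :
    ∃ σ : Equiv.Perm (Fin n), lamVec X ∘ σ = lamVec X ∧ μ' = (-μ) ∘ σ := by
  obtain ⟨V, hV⟩ := aux_OSet_nonempty X hX
  apply aux_perm
  intro v s
  rw [aux_key hX hH.neg hV v s le_rfl μ' hμ']
  have h1 := aux_key hX hH hV v (-s) le_rfl μ hμ
  have e : s • (1 : Matrix {i // lamVec X i = v} {i // lamVec X i = v} ℝ)
        - (Vᵀ * (-H) * V).toSquareBlockProp (fun i => lamVec X i = v)
      = -((-s) • (1 : Matrix {i // lamVec X i = v} {i // lamVec X i = v} ℝ)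
        - (Vᵀ * H * V).toSquareBlockProp (fun i => lamVec X i = v)) := by
    ext i j
    simp [toSquareBlockProp_def]
    ring
  rw [e, det_neg, ← h1, Fintype.card_subtype, ← Finset.prod_const, ← Finset.prod_mul_distrib]
  refine Finset.prod_congr rfl fun i _ => ?_
  simp only [Pi.neg_apply]
  ring

/-- If the derivatives on a block coincide, the compressed direction is scalar there. -/
theorem aux_scalar {n : ℕ} {X H V : Matrix (Fin n) (Fin n) ℝ} (hX : X.IsSymm) (hH : H.IsSymm)
    (hV : V ∈ OSet X) (μ : Fin n → ℝ)
    (hμ : ∀ i, Tendsto (fun t => (lamVec (X + t • H) i - lamVec X i) / t) (𝓝[>] 0) (𝓝 (μ i)))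
    (v r : ℝ) (hr : ∀ i, lamVec X i = v → μ i = r) (i j : Fin n) (hi : lamVec X i = v)
    (hj : lamVec X j = v) : (Vᵀ * H * V) i j = if i = j then r else 0 := by
  set B := (Vᵀ * H * V).toSquareBlockProp (fun i => lamVec X i = v) with hB
  have hsym : (Vᵀ * H * V)ᵀ = Vᵀ * H * V := by
    rw [transpose_mul, transpose_mul, transpose_transpose, hH.eq, Matrix.mul_assoc]
  have hBh : B.IsHermitian := by
    ext a c
    simpa [hB, toSquareBlockProp_def] using congrFun (congrFun hsym a) c
  have heig : ∀ a, hBh.eigenvalues a = r := by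
    intro a
    have h1 := aux_key hX hH hV v (hBh.eigenvalues a) le_rfl μ hμ
    have h2 : (hBh.eigenvalues a • (1 : Matrix {i // lamVec X i = v} {i // lamVec X i = v} ℝ)
        - B).det = 0 := by
      have h3 : (B.charpoly).eval (hBh.eigenvalues a) = 0 := by
        rw [hBh.charpoly_eq, Polynomial.eval_prod]
        exact Finset.prod_eq_zero (Finset.mem_univ a) (by simp)
      rw [Matrix.eval_charpoly] at h3
      rw [← h3]
      congr 1
      ext x y
      simp [Matrix.scalar_apply, Matrix.one_apply, Matrix.diagonal_apply]
    rw [h2] at h1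
    obtain ⟨k, hk, hk0⟩ := Finset.prod_eq_zero_iff.mp h1
    rw [← hr k (Finset.mem_filter.mp hk).2]
    linarith
  have hBr : B = r • 1 := by
    have h1 := hBh.spectral_theorem
    have h2 : diagonal ((RCLike.ofReal : ℝ → ℝ) ∘ hBh.eigenvalues)
        = r • (1 : Matrix {i // lamVec X i = v} {i // lamVec X i = v} ℝ) := by
      ext x y
      by_cases hxy : x = y
      · subst hxy; simp [heig]
      · simp [hxy]
    rw [h2, map_smul, map_one] at h1
    exact h1
  have := congrFun (congrFun hBr ⟨i, hi⟩) ⟨j, hj⟩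
  simpa [hB, toSquareBlockProp_def, Matrix.one_apply] using this

/-- The active set as a finset. -/
def auxAct {n q : ℕ} (b : Fin q → Fin n → ℝ) (d : Fin q → ℝ) (x : Fin n → ℝ) : Finset (Fin q) :=
  Finset.univ.filter fun i => i ∈ iotaC b d x

theorem aux_act_nonempty {n q : ℕ} [NeZero q] (b : Fin q → Fin n → ℝ) (d : Fin q → ℝ)
    (x : Fin n → ℝ) (hx : pwa b d x = 0) : (auxAct b d x).Nonempty := by
  obtain ⟨i, hi⟩ := exists_eq_ciSup_of_finite (f := fun i => b i ⬝ᵥ x - d i)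
  refine ⟨i, Finset.mem_filter.mpr ⟨Finset.mem_univ _, ?_⟩⟩
  unfold pwa at hx
  rw [hx] at hi
  exact sub_eq_zero.mp hi

theorem aux_pwa {n q : ℕ} [NeZero q] (b : Fin q → Fin n → ℝ) (d : Fin q → ℝ)
    (x : Fin n → ℝ) (hx : pwa b d x = 0) (m : ℝ → Fin n → ℝ) (μ : Fin n → ℝ)
    (hm : Tendsto m (𝓝[>] 0) (𝓝 μ)) :
    Tendsto (fun t => pwa b d (x + t • m t) / t) (𝓝[>] 0)
      (𝓝 ((auxAct b d x).sup' (aux_act_nonempty b d x hx) fun i => b i ⬝ᵥ μ)) := by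
  have hpos : ∀ᶠ t in 𝓝[>] (0:ℝ), (0:ℝ) < t := self_mem_nhdsWithin
  have ht0 : Tendsto (fun t : ℝ => t) (𝓝[>] 0) (𝓝 0) := nhdsWithin_le_nhds
  have hne := aux_act_nonempty b d x hx
  have hdot : ∀ i, Tendsto (fun t => b i ⬝ᵥ m t) (𝓝[>] 0) (𝓝 (b i ⬝ᵥ μ)) := by
    intro i
    have hc : Continuous fun y : Fin n → ℝ => b i ⬝ᵥ y := by
      unfold dotProduct; fun_prop
    exact (hc.tendsto μ).comp hm
  have hval : ∀ i, Tendsto (fun t => b i ⬝ᵥ x - d i + t * (b i ⬝ᵥ m t)) (𝓝[>] 0)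
      (𝓝 (b i ⬝ᵥ x - d i)) := by
    intro i
    have := (tendsto_const_nhds (x := b i ⬝ᵥ x - d i)).add (ht0.mul (hdot i))
    simpa using this
  have hexp : ∀ i t, b i ⬝ᵥ (x + t • m t) - d i = b i ⬝ᵥ x - d i + t * (b i ⬝ᵥ m t) := by
    intro i t
    rw [dotProduct_add, dotProduct_smul, smul_eq_mul]; ring
  have hact : ∀ i ∈ auxAct b d x, b i ⬝ᵥ x - d i = 0 := fun i hi =>
    sub_eq_zero.mpr (Finset.mem_filter.mp hi).2
  have hinact : ∀ i ∉ auxAct b d x, b i ⬝ᵥ x - d i < 0 := by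
    intro i hi
    refine lt_of_le_of_ne ?_ fun h => hi (Finset.mem_filter.mpr ⟨Finset.mem_univ _, ?_⟩)
    · rw [← hx]
      exact le_ciSup (f := fun i => b i ⬝ᵥ x - d i) (Set.finite_range _).bddAbove i
    · exact sub_eq_zero.mp h
  obtain ⟨i0, hi0⟩ := id hne
  have hev : ∀ᶠ t in 𝓝[>] (0:ℝ), ∀ i, i ∉ auxAct b d x →
      b i ⬝ᵥ x - d i + t * (b i ⬝ᵥ m t) < b i0 ⬝ᵥ x - d i0 + t * (b i0 ⬝ᵥ m t) := by
    rw [eventually_all]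
    intro i
    by_cases hi : i ∈ auxAct b d x
    · exact Eventually.of_forall fun t h => absurd hi h
    · have := (hval i).eventually_lt (hval i0) (by rw [hact i0 hi0]; exact hinact i hi)
      filter_upwards [this] with t ht _ using ht
  refine (Tendsto.finset_sup'_nhds_apply hne fun i _ => hdot i).congr' ?_
  filter_upwards [hev, hpos] with t ht htp
  rw [eq_div_iff htp.ne']
  apply le_antisymm
  · obtain ⟨i, hi, hie⟩ := Finset.exists_mem_eq_sup' hne fun i => b i ⬝ᵥ m t
    rw [hie]
    have h1 : b i ⬝ᵥ (x + t • m t) - d i ≤ pwa b d (x + t • m t) :=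
      le_ciSup (f := fun i => b i ⬝ᵥ (x + t • m t) - d i) (Set.finite_range _).bddAbove i
    rw [hexp, hact i hi] at h1
    linarith
  · refine ciSup_le fun i => ?_
    have hk : ∀ i ∈ auxAct b d x, b i ⬝ᵥ x - d i + t * (b i ⬝ᵥ m t)
        ≤ ((auxAct b d x).sup' hne fun i => b i ⬝ᵥ m t) * t := by
      intro i hi
      rw [hact i hi, zero_add, mul_comm]
      exact mul_le_mul_of_nonneg_right (Finset.le_sup' (fun i => b i ⬝ᵥ m t) hi) htp.le
    rw [hexp]
    by_cases hi : i ∈ auxAct b d x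
    · exact hk i hi
    · exact (ht i hi).le.trans (hk i0 hi0)

theorem aux_sup_perm {n q : ℕ} [NeZero q] (b : Fin q → Fin n → ℝ) (d : Fin q → ℝ)
    (hsym : ∀ (σ : Equiv.Perm (Fin n)) (x : Fin n → ℝ), pwa b d (x ∘ σ) = pwa b d x)
    (x : Fin n → ℝ) (hx : pwa b d x = 0) (σ : Equiv.Perm (Fin n)) (hσ : x ∘ σ = x)
    (μ : Fin n → ℝ) :
    ((auxAct b d x).sup' (aux_act_nonempty b d x hx) fun i => b i ⬝ᵥ (μ ∘ σ))
      = (auxAct b d x).sup' (aux_act_nonempty b d x hx) fun i => b i ⬝ᵥ μ := by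
  have h1 := aux_pwa b d x hx (fun _ => μ) μ tendsto_const_nhds
  have h2 := aux_pwa b d x hx (fun _ => μ ∘ σ) (μ ∘ σ) tendsto_const_nhds
  refine tendsto_nhds_unique h2 (h1.congr fun t => ?_)
  rw [← hsym σ (x + t • μ)]
  congr 2
  funext i
  have := congrFun hσ i
  simp only [Function.comp_apply, Pi.add_apply, Pi.smul_apply] at this ⊢
  rw [this]

theorem aux_zeta {n q : ℕ} [NeZero q] (b : Fin q → Fin n → ℝ) (d : Fin q → ℝ)
    (X H : Matrix (Fin n) (Fin n) ℝ) (hx : pwa b d (lamVec X) = 0) (μ : Fin n → ℝ)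
    (hμ : ∀ i, Tendsto (fun t => (lamVec (X + t • H) i - lamVec X i) / t) (𝓝[>] 0) (𝓝 (μ i))) :
    dirDeriv (fun Y => pwa b d (lamVec Y)) X H
      = (auxAct b d (lamVec X)).sup' (aux_act_nonempty b d _ hx) fun i => b i ⬝ᵥ μ := by
  have hpos : ∀ᶠ t in 𝓝[>] (0:ℝ), (0:ℝ) < t := self_mem_nhdsWithin
  have h1 := aux_pwa b d (lamVec X) hx _ μ (tendsto_pi_nhds.mpr hμ)
  unfold dirDeriv
  refine Tendsto.limUnder_eq (h1.congr' ?_)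
  filter_upwards [hpos] with t ht
  rw [hx, sub_zero]
  congr 2
  funext i
  simp only [Pi.add_apply, Pi.smul_apply, smul_eq_mul]
  field_simp
  ring

theorem aux_lin_iff {n q : ℕ} [NeZero q] (b : Fin q → Fin n → ℝ) (d : Fin q → ℝ)
    (x : Fin n → ℝ) (hx : pwa b d x = 0) (μ : Fin n → ℝ) :
    (((auxAct b d x).sup' (aux_act_nonempty b d x hx) fun i => b i ⬝ᵥ μ) = 0 ∧
     ((auxAct b d x).sup' (aux_act_nonempty b d x hx) fun i => b i ⬝ᵥ (-μ)) = 0) ↔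
      ∀ i ∈ iotaC b d x, μ ⬝ᵥ b i = 0 := by
  constructor
  · rintro ⟨h1, h2⟩ i hi
    have hi' : i ∈ auxAct b d x := Finset.mem_filter.mpr ⟨Finset.mem_univ _, hi⟩
    have e1 := Finset.le_sup' (fun i => b i ⬝ᵥ μ) hi'
    have e2 := Finset.le_sup' (fun i => b i ⬝ᵥ (-μ)) hi'
    rw [h1] at e1
    rw [h2] at e2
    simp only [dotProduct_neg] at e1 e2
    rw [dotProduct_comm]
    linarith
  · intro h
    have hz : ∀ i ∈ auxAct b d x, b i ⬝ᵥ μ = 0 := fun i hi => by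
      rw [dotProduct_comm]; exact h i (Finset.mem_filter.mp hi).2
    constructor
    · rw [Finset.sup'_congr _ rfl hz]; simp
    · rw [Finset.sup'_congr (g := fun _ => (0:ℝ)) _ rfl
        (fun i hi => by rw [dotProduct_neg, hz i hi, neg_zero])]
      simp

/-- If `μ` is in the lineality space, it is constant on every bad block. -/
theorem aux_const {n q : ℕ} [NeZero q] (b : Fin q → Fin n → ℝ) (d : Fin q → ℝ)
    (hsym : ∀ (σ : Equiv.Perm (Fin n)) (x : Fin n → ℝ), pwa b d (x ∘ σ) = pwa b d x)
    (x : Fin n → ℝ) (hx : pwa b d x = 0) (μ : Fin n → ℝ)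
    (h : ∀ i ∈ iotaC b d x, μ ⬝ᵥ b i = 0) (i' j' : Fin n) (hij : x i' = x j')
    (w : Fin q) (hw : w ∈ iotaC b d x) (hb : b w i' ≠ b w j') (k : Fin n) (hk : x k = x i') :
    μ k = μ i' := by
  have hperm : ∀ σ : Equiv.Perm (Fin n), x ∘ σ = x → (μ ∘ σ) ⬝ᵥ b w = 0 := by
    intro σ hσ
    refine (aux_lin_iff b d x hx (μ ∘ σ)).mp ?_ w hw
    have h0 := (aux_lin_iff b d x hx μ).mpr h
    refine ⟨(aux_sup_perm b d hsym x hx σ hσ μ).trans h0.1, ?_⟩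
    exact (aux_sup_perm b d hsym x hx σ hσ (-μ)).trans h0.2
  have hswap : ∀ a c : Fin n, x a = x c → x ∘ (Equiv.swap a c) = x := by
    intro a c hac
    funext y
    rw [Function.comp_apply, Equiv.swap_apply_def]
    split_ifs with h1 h2
    · rw [h1, hac]
    · rw [h2, hac]
    · rfl
  have hgen : ∀ ν : Fin n → ℝ, ν ⬝ᵥ b w = 0 → (ν ∘ Equiv.swap i' j') ⬝ᵥ b w = 0 →
      ν i' = ν j' := by
    intro ν h1 h2
    have hne : i' ≠ j' := fun h => hb (by rw [h])
    have h3 : (ν - ν ∘ Equiv.swap i' j') ⬝ᵥ b w = 0 := by rw [sub_dotProduct, h1, h2, sub_zero]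
    have h4 : (ν - ν ∘ Equiv.swap i' j') ⬝ᵥ b w
        = (ν i' - ν j') * b w i' + (ν j' - ν i') * b w j' := by
      unfold dotProduct
      rw [Finset.sum_eq_add_of_mem i' j' (Finset.mem_univ _) (Finset.mem_univ _) hne]
      · simp
      · intro c _ hc
        simp [Equiv.swap_apply_of_ne_of_ne hc.1 hc.2]
    rw [h4] at h3
    have h5 : (ν i' - ν j') * (b w i' - b w j') = 0 := by linarith
    rcases mul_eq_zero.mp h5 with h6 | h6
    · linarith
    · exact absurd (by linarith) hb
  have hs := hswap i' j' hij
  have e0 : μ i' = μ j' := hgen μ (h w hw) (hperm _ hs)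
  by_cases hkj : k = j'
  · rw [hkj, e0]
  by_cases hki : k = i'
  · rw [hki]
  have hs2 := hswap k j' (hk.trans hij)
  have e1 := hgen (μ ∘ Equiv.swap k j') (hperm _ hs2) (by
    have := hperm ((Equiv.swap i' j').trans (Equiv.swap k j')) (by
      rw [Equiv.coe_trans, ← Function.comp_assoc, hs2, hs])
    rwa [Equiv.coe_trans, ← Function.comp_assoc] at this)
  have hne : i' ≠ j' := fun h => hb (by rw [h])
  rw [Function.comp_apply, Function.comp_apply, Equiv.swap_apply_right,
    Equiv.swap_apply_of_ne_of_ne (Ne.symm hki) hne] at e1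
  exact e1.symm

/-- Proposition 3.5.  Characterization of the lineality space
`lin(T_K(X̄)) = {H ∈ Sⁿ : ζ'(X̄;H) = -ζ'(X̄;-H) = 0}` of the tangent cone of
`K = {X ∈ Sⁿ : ζ(X) ≤ 0}` at `X̄` with `ζ(X̄) = 0`: membership is equivalent to
`⟨λ'(X̄;H), bⁱ⟩ = 0` for all `i ∈ ι₂(λ(X̄))`, and membership forces
`V̄ᵀ_{αˡ} H V̄_{αˡ} = ρ̃ₗ I` on every "bad" eigenvalue block, for every `V̄ ∈ 𝕆ⁿ(X̄)`. -/
theorem stmt9 {n q : ℕ} [NeZero q]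
    (b : Fin q → Fin n → ℝ) (d : Fin q → ℝ)
    (hsym : ∀ (σ : Equiv.Perm (Fin n)) (x : Fin n → ℝ), pwa b d (x ∘ σ) = pwa b d x)
    (zeta : Matrix (Fin n) (Fin n) ℝ → ℝ)
    (hzeta : zeta = fun X => pwa b d (lamVec X))
    (K : Set (Matrix (Fin n) (Fin n) ℝ))
    (hK : K = {X | X.IsSymm ∧ zeta X ≤ 0})
    (hSlater : ∃ Xt : Matrix (Fin n) (Fin n) ℝ, Xt.IsSymm ∧ zeta Xt < 0)
    (Xb : Matrix (Fin n) (Fin n) ℝ) (hXbK : Xb ∈ K) (hXb0 : zeta Xb = 0)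
    (H : Matrix (Fin n) (Fin n) ℝ) (hH : H.IsSymm) :
    ((dirDeriv zeta Xb H = 0 ∧ dirDeriv zeta Xb (-H) = 0) ↔
      ∀ i ∈ iotaC b d (lamVec Xb), lamDD Xb H ⬝ᵥ b i = 0) ∧
    ((dirDeriv zeta Xb H = 0 ∧ dirDeriv zeta Xb (-H) = 0) →
      ∃ ρ : Fin n → ℝ, (∀ i j : Fin n, lamVec Xb i = lamVec Xb j → ρ i = ρ j) ∧
        ∀ V ∈ OSet Xb, ∀ i j : Fin n, lamVec Xb i = lamVec Xb j →
          (∃ i' j' : Fin n, lamVec Xb i' = lamVec Xb i ∧ lamVec Xb j' = lamVec Xb i ∧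
            ∃ w ∈ iotaC b d (lamVec Xb), b w i' ≠ b w j') →
          (Vᵀ * H * V) i j = if i = j then ρ i else 0) := by
  subst hzeta
  have hX : Xb.IsSymm := by rw [hK] at hXbK; exact hXbK.1
  obtain ⟨μ, hμ⟩ := aux_exists_s9 Xb H hX hH
  obtain ⟨μ', hμ'⟩ := aux_exists_s9 Xb (-H) hX hH.neg
  obtain ⟨σ, hσ, hσμ⟩ := aux_neg hX hH μ μ' hμ hμ'
  have hdd : lamDD Xb H = μ := by
    funext i
    exact (hμ i).limUnder_eq
  have hiff : (dirDeriv (fun X => pwa b d (lamVec X)) Xb H = 0 ∧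
      dirDeriv (fun X => pwa b d (lamVec X)) Xb (-H) = 0) ↔
      ∀ i ∈ iotaC b d (lamVec Xb), μ ⬝ᵥ b i = 0 := by
    rw [aux_zeta b d Xb H hXb0 μ hμ, aux_zeta b d Xb (-H) hXb0 μ' hμ', hσμ,
      aux_sup_perm b d hsym _ hXb0 σ hσ (-μ)]
    exact aux_lin_iff b d _ hXb0 μ
  rw [hdd]
  refine ⟨hiff, fun hlin => ?_⟩
  have hz := hiff.mp hlin
  let bad : ℝ → Prop := fun v => ∃ i' j' : Fin n, lamVec Xb i' = v ∧ lamVec Xb j' = v ∧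
            ∃ w ∈ iotaC b d (lamVec Xb), b w i' ≠ b w j'
  have hconst : ∀ v, bad v → ∀ i j, lamVec Xb i = v → lamVec Xb j = v → μ i = μ j := by
    rintro v ⟨i', j', hi', hj', w, hw, hb⟩ i j hi hj
    have h1 := aux_const b d hsym _ hXb0 μ hz i' j' (hi'.trans hj'.symm) w hw hb
    rw [h1 i (hi.trans hi'.symm), h1 j (hj.trans hi'.symm)]
  refine ⟨fun i => if bad (lamVec Xb i) then μ i else 0, ?_, ?_⟩
  · intro i j hij
    by_cases hb : bad (lamVec Xb i)
    · have hb' : bad (lamVec Xb j) := hij ▸ hb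
      simp only [hb, hb', if_true]
      exact hconst _ hb i j rfl hij.symm
    · have hb' : ¬ bad (lamVec Xb j) := hij ▸ hb
      simp only [hb, hb', if_false]
  · intro V hV i j hij hb
    have hb : bad (lamVec Xb i) := hb
    simp only [hb, if_true]
    exact aux_scalar hX hH hV μ hμ (lamVec Xb i) (μ i)
      (fun k hk => hconst _ hb k i hk rfl) i j rfl hij.symm

end
end
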